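/- arXiv:1811.09092 — 4 statements merged into one kernel-verified Lean document; each statement's English description precedes it below -/
import Mathlib

section
/- The minimal Dress ring D of ℝ(X) is a Dedekind domain. -/
open Polynomial
noncomputable abbrev DD : Subring (RatFunc ℝ) := Subring.closure {s : RatFunc ℝ | ∃ x : RatFunc ℝ, s = (1 + x ^ 2)⁻¹}

theorem one_add_sq_ne (x : RatFunc ℝ) : 1 + x^2 ≠ 0 := by
  intro h
  have hd : (algebraMap ℝ[X] (RatFunc ℝ)) x.denom ≠ 0 := RatFunc.algebraMap_ne_zero x.denom_ne_zero
  have hx := x.num_div_denom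
  rw [← hx] at h
  field_simp at h
  rw [mul_zero, ← map_pow, ← map_pow, ← map_add, map_eq_zero_iff _ (RatFunc.algebraMap_injective ℝ)] at h
  obtain ⟨a, b, hab⟩ := x.isCoprime_num_denom
  obtain ⟨t, ht⟩ : ∃ t : ℝ, x.denom.eval t ≠ 0 := by
    by_contra! hc
    exact x.denom_ne_zero (Polynomial.funext (by simpa using hc))
  have h2 := congrArg (Polynomial.eval t) h
  simp at h2
  have : 0 < (x.denom.eval t)^2 := by positivity
  nlinarith [sq_nonneg (x.num.eval t)]

theorem gen_mem (x : RatFunc ℝ) : (1 + x^2)⁻¹ ∈ DD := Subring.subset_closure ⟨x, rfl⟩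

theorem const_mem (c : ℝ) : algebraMap ℝ (RatFunc ℝ) c ∈ DD := by
  have h1 : ∀ c : ℝ, 0 < c → c ≤ 1 → algebraMap ℝ (RatFunc ℝ) c ∈ DD := by
    intro c h0 h1
    have : c = (1 + (Real.sqrt (c⁻¹ - 1))^2)⁻¹ := by
      rw [Real.sq_sqrt]
      · simp
      · have := (one_le_inv₀ h0).2 h1
        linarith
    rw [this]
    have := gen_mem (algebraMap ℝ (RatFunc ℝ) (Real.sqrt (c⁻¹ - 1)))
    simpa using this
  have h2 : ∀ c : ℝ, 0 < c → algebraMap ℝ (RatFunc ℝ) c ∈ DD := by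
    intro c h0
    have hc : c = (⌈c⌉₊ : ℕ) * (c / ⌈c⌉₊) := by
      have : 0 < ⌈c⌉₊ := Nat.ceil_pos.2 h0
      field_simp
    rw [hc, map_mul, map_natCast]
    refine mul_mem (natCast_mem _ _) (h1 _ ?_ ?_)
    · have : 0 < ⌈c⌉₊ := Nat.ceil_pos.2 h0
      positivity
    · exact div_le_one_of_le₀ (Nat.le_ceil c) (by positivity)
  rcases lt_trichotomy c 0 with h | h | h
  · have := neg_mem (h2 (-c) (by linarith))
    simpa using this
  · simp [h]
  · exact h2 c h

theorem lin_mem (x : RatFunc ℝ) : x * (1 + x^2)⁻¹ ∈ DD := by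
  have hh : (algebraMap ℝ (RatFunc ℝ) (1/2)) = 1/2 := by rw [map_div₀, map_one, map_ofNat]
  by_cases hx : x = 1
  · subst hx
    simpa using gen_mem 1
  · have h1 : 1 - x ≠ 0 := sub_ne_zero.2 (Ne.symm hx)
    have h2 := gen_mem ((1 + x) / (1 - x))
    have h3 := one_add_sq_ne x
    have h4 : x * (1 + x^2)⁻¹ = algebraMap ℝ (RatFunc ℝ) (1/2) - (1 + ((1 + x) / (1 - x))^2)⁻¹ := by
      have h5 := one_add_sq_ne ((1 + x) / (1 - x))
      have h6 : (1 + ((1 + x) / (1 - x))^2) = 2 * (1 + x^2) / (1-x)^2 := by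
        field_simp; ring
      have h7 : (2 : RatFunc ℝ) ≠ 0 := two_ne_zero
      rw [hh, h6]; field_simp; ring
    rw [h4]
    exact sub_mem (const_mem _) h2


theorem quad_mem (f q : ℝ[X]) (hq : q.natDegree = 2) (hr : ∀ t, q.eval t ≠ 0)
    (hf : f.natDegree ≤ 2) :
    algebraMap ℝ[X] (RatFunc ℝ) f / algebraMap ℝ[X] (RatFunc ℝ) q ∈ DD := by
  have eqq := Polynomial.as_sum_range_C_mul_X_pow' q (n := 3) (by omega)
  have eqf := Polynomial.as_sum_range_C_mul_X_pow' f (n := 3) (by omega)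
  have ha : q.coeff 2 ≠ 0 := by
    rw [← hq]
    simp only [coeff_natDegree, ne_eq, leadingCoeff_eq_zero]
    rintro rfl; simp at hq
  simp only [Finset.sum_range_succ, Finset.sum_range_zero, pow_zero, mul_one, pow_one,
    zero_add] at eqq eqf
  obtain ⟨a, had⟩ : ∃ a, q.coeff 2 = a := ⟨_, rfl⟩
  obtain ⟨b, hbd⟩ : ∃ b, q.coeff 1 = b := ⟨_, rfl⟩
  obtain ⟨c, hcd⟩ : ∃ c, q.coeff 0 = c := ⟨_, rfl⟩
  obtain ⟨f2, hf2⟩ : ∃ c, f.coeff 2 = c := ⟨_, rfl⟩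
  obtain ⟨f1, hf1⟩ : ∃ c, f.coeff 1 = c := ⟨_, rfl⟩
  obtain ⟨f0, hf0⟩ : ∃ c, f.coeff 0 = c := ⟨_, rfl⟩
  rw [had] at ha
  rw [had, hbd, hcd] at eqq
  rw [hf0, hf1, hf2] at eqf
  obtain ⟨s, hs⟩ : ∃ s : ℝ, b = - 2 * a * s := ⟨-b / (2 * a), by field_simp⟩
  obtain ⟨e, he⟩ : ∃ e : ℝ, c = a * (s ^ 2 + e) := ⟨c / a - s ^ 2, by field_simp; ring⟩
  have hepos : 0 < e := by
    by_contra! hc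
    apply hr (s + Real.sqrt (-e))
    have h := Real.sq_sqrt (show 0 ≤ -e by linarith)
    rw [eqq, hs, he]
    simp only [eval_add, eval_mul, eval_C, eval_X, eval_pow]
    linear_combination a * h
  obtain ⟨t, ht, hte⟩ : ∃ t : ℝ, t ≠ 0 ∧ e = t ^ 2 :=
    ⟨Real.sqrt e, (Real.sqrt_pos.2 hepos).ne', (Real.sq_sqrt hepos.le).symm⟩
  set ι := algebraMap ℝ (RatFunc ℝ) with hι
  have hC : ∀ r : ℝ, algebraMap ℝ[X] (RatFunc ℝ) (C r) = ι r := fun r => by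
    rw [hι, IsScalarTower.algebraMap_apply ℝ ℝ[X] (RatFunc ℝ)]; rfl
  have ha' : ι a ≠ 0 := (map_ne_zero ι).2 ha
  have ht' : ι t ≠ 0 := (map_ne_zero ι).2 ht
  set x := algebraMap ℝ[X] (RatFunc ℝ) X with hx
  obtain ⟨Y, hY⟩ : ∃ Y, x = ι s + ι t * Y := ⟨(x - ι s) / ι t, by field_simp; ring⟩
  have hY0 := one_add_sq_ne Y
  have e1 : algebraMap ℝ[X] (RatFunc ℝ) q = ι a * ι t ^ 2 * (1 + Y ^ 2) := by
    rw [eqq]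
    simp only [map_add, map_mul, map_pow, hC]
    rw [← hx, hY, hs, he, hte]
    simp only [map_mul, map_neg, map_add, map_pow, map_ofNat]
    ring
  have e2 : algebraMap ℝ[X] (RatFunc ℝ) f = ι (f0 + f1 * s + f2 * s ^ 2 - f2 * t ^ 2) +
      ι (f1 * t + 2 * s * t * f2) * Y + ι (f2 * t ^ 2) * (1 + Y ^ 2) := by
    rw [eqf]
    simp only [map_add, map_mul, map_pow, hC, map_sub, map_ofNat]
    rw [← hx, hY]
    ring
  have e3 : algebraMap ℝ[X] (RatFunc ℝ) f / algebraMap ℝ[X] (RatFunc ℝ) q =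
      ι ((a * t ^ 2)⁻¹) * (ι (f0 + f1 * s + f2 * s ^ 2 - f2 * t ^ 2) * (1 + Y ^ 2)⁻¹ +
      ι (f1 * t + 2 * s * t * f2) * (Y * (1 + Y ^ 2)⁻¹) + ι (f2 * t ^ 2)) := by
    rw [e1, e2, map_inv₀, map_mul ι a, map_pow ι t]
    generalize ι (f0 + f1 * s + f2 * s ^ 2 - f2 * t ^ 2) = A
    generalize ι (f1 * t + 2 * s * t * f2) = B
    generalize ι (f2 * t ^ 2) = G
    field_simp
  rw [e3]
  exact mul_mem (const_mem _) (add_mem (add_mem (mul_mem (const_mem _) (gen_mem _))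
    (mul_mem (const_mem _) (lin_mem _))) (const_mem _))

theorem frac_mem (n : ℕ) : ∀ (f p : ℝ[X]), p.natDegree = n → (∀ t, p.eval t ≠ 0) →
    f.natDegree ≤ p.natDegree →
    algebraMap ℝ[X] (RatFunc ℝ) f / algebraMap ℝ[X] (RatFunc ℝ) p ∈ DD := by
  induction n using Nat.strong_induction_on with
  | _ n ih =>
  intro f p hn hp hf
  have hp0 : p ≠ 0 := by rintro rfl; exact hp 0 (by simp)
  have hC : ∀ r : ℝ, algebraMap ℝ[X] (RatFunc ℝ) (C r) = algebraMap ℝ (RatFunc ℝ) r := fun r => by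
    rw [IsScalarTower.algebraMap_apply ℝ ℝ[X] (RatFunc ℝ)]; rfl
  by_cases h0 : p.natDegree = 0
  · rw [Polynomial.eq_C_of_natDegree_eq_zero h0,
      Polynomial.eq_C_of_natDegree_eq_zero (by omega : f.natDegree = 0), hC, hC, ← map_div₀]
    exact const_mem _
  · obtain ⟨q, hq, r, rfl⟩ := Polynomial.exists_irreducible_of_natDegree_ne_zero h0
    have hq0 : q ≠ 0 := hq.ne_zero
    have hr0 : r ≠ 0 := by rintro rfl; simp at hp0
    have hqr : ∀ t, q.eval t ≠ 0 := fun t h => hp t (by simp [h])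
    have hrr : ∀ t, r.eval t ≠ 0 := fun t h => hp t (by simp [h])
    have hq2 : q.natDegree = 2 := by
      have h1 := hq.natDegree_le_two
      have h2 := hq.natDegree_pos
      have h3 : q.natDegree ≠ 1 := by
        intro h
        obtain ⟨x, hx⟩ := Polynomial.exists_root_of_degree_eq_one
          ((Polynomial.degree_eq_iff_natDegree_eq hq0).2 h)
        exact hqr x hx
      omega
    have hd := Polynomial.natDegree_mul hq0 hr0
    have hm := Polynomial.natDegree_mod_lt f (q := q) (by omega)
    have hdm := EuclideanDomain.div_add_mod f q
    have hdiv : (f / q).natDegree ≤ r.natDegree := by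
      by_cases hz : f / q = 0
      · simp [hz]
      have h1 := Polynomial.natDegree_mul hq0 hz
      have h2 : q * (f / q) = f - f % q := by rw [eq_sub_iff_add_eq, hdm]
      have h3 := Polynomial.natDegree_sub_le f (f % q)
      rw [← h2] at h3
      have h4 : max f.natDegree (f % q).natDegree ≤ (q * r).natDegree :=
        max_le hf (by omega)
      omega
    have m1 := ih r.natDegree (by omega) (f / q) r rfl hrr hdiv
    have m2 := ih r.natDegree (by omega) 1 r rfl hrr (by simp)
    have m3 := quad_mem (f % q) q hq2 hqr (by omega)
    have a1 : algebraMap ℝ[X] (RatFunc ℝ) q ≠ 0 := RatFunc.algebraMap_ne_zero hq0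
    have a2 : algebraMap ℝ[X] (RatFunc ℝ) r ≠ 0 := RatFunc.algebraMap_ne_zero hr0
    have key := add_mem m1 (mul_mem m3 m2)
    convert key using 1
    have h5 := congrArg (algebraMap ℝ[X] (RatFunc ℝ)) hdm
    rw [map_add, map_mul] at h5
    rw [← h5, map_mul, map_one]
    field_simp

theorem deg_sq_add (m n : ℝ[X]) (hm : m ≠ 0) (h : n.natDegree ≤ m.natDegree) :
    2 * m.natDegree ≤ (m ^ 2 + n ^ 2).natDegree := by
  apply Polynomial.le_natDegree_of_ne_zero
  rw [Polynomial.coeff_add, Polynomial.coeff_pow_of_natDegree_le le_rfl,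
    Polynomial.coeff_pow_of_natDegree_le h]
  have : 0 < (m.coeff m.natDegree) ^ 2 := by
    have : m.coeff m.natDegree ≠ 0 := by simpa using hm
    positivity
  nlinarith [sq_nonneg (n.coeff m.natDegree)]

theorem exists_frac (x : RatFunc ℝ) (hx : x ∈ DD) : ∃ f p : ℝ[X], (∀ t, p.eval t ≠ 0) ∧
    f.natDegree ≤ p.natDegree ∧
    x = algebraMap ℝ[X] (RatFunc ℝ) f / algebraMap ℝ[X] (RatFunc ℝ) p := by
  have nz : ∀ p : ℝ[X], (∀ t, p.eval t ≠ 0) → p ≠ 0 := by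
    rintro p hp rfl; exact hp 0 (by simp)
  have nz' : ∀ p : ℝ[X], (∀ t, p.eval t ≠ 0) → algebraMap ℝ[X] (RatFunc ℝ) p ≠ 0 :=
    fun p hp => RatFunc.algebraMap_ne_zero (nz p hp)
  induction hx using Subring.closure_induction with
  | mem s hs =>
    obtain ⟨x, rfl⟩ := hs
    have hcop := x.isCoprime_num_denom
    have hd0 := x.denom_ne_zero
    have hd : (algebraMap ℝ[X] (RatFunc ℝ)) x.denom ≠ 0 := RatFunc.algebraMap_ne_zero hd0
    have h1 := one_add_sq_ne x
    have hx := x.num_div_denom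
    generalize x.num = n at *
    generalize x.denom = m at *
    have hroot : ∀ t, (m ^ 2 + n ^ 2).eval t ≠ 0 := by
      intro t ht
      simp only [eval_add, eval_pow] at ht
      have hm : m.eval t = 0 := by nlinarith [sq_nonneg (m.eval t), sq_nonneg (n.eval t)]
      have hn : n.eval t = 0 := by nlinarith [sq_nonneg (m.eval t), sq_nonneg (n.eval t)]
      obtain ⟨a, b, hab⟩ := hcop
      have := congrArg (Polynomial.eval t) hab
      simp [hm, hn] at this
    refine ⟨m ^ 2, m ^ 2 + n ^ 2, hroot, ?_, ?_⟩
    · rw [Polynomial.natDegree_pow]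
      rcases le_total n.natDegree m.natDegree with h | h
      · exact deg_sq_add m n hd0 h
      · by_cases hn : n = 0
        · subst hn; simp
        · have := deg_sq_add n m hn h
          rw [add_comm (m ^ 2)]
          omega
    · have h2 := nz' _ hroot
      rw [map_add, map_pow, map_pow] at h2 ⊢
      rw [inv_eq_one_div, div_eq_div_iff h1 h2, ← hx]
      field_simp
  | zero => exact ⟨0, 1, by simp, by simp, by simp⟩
  | one => exact ⟨1, 1, by simp, by simp, by simp⟩
  | neg x _ ih =>
    obtain ⟨f, p, hp, hf, rfl⟩ := ih
    exact ⟨-f, p, hp, by simpa using hf, by rw [map_neg, neg_div]⟩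
  | add x y _ _ ihx ihy =>
    obtain ⟨f, p, hp, hf, rfl⟩ := ihx
    obtain ⟨g, q, hq, hg, rfl⟩ := ihy
    refine ⟨f * q + p * g, p * q, fun t => by simp [hp t, hq t], ?_, ?_⟩
    · rw [Polynomial.natDegree_mul (nz p hp) (nz q hq)]
      refine (Polynomial.natDegree_add_le _ _).trans (max_le ?_ ?_)
      · exact Polynomial.natDegree_mul_le.trans (by omega)
      · exact Polynomial.natDegree_mul_le.trans (by omega)
    · rw [div_add_div _ _ (nz' p hp) (nz' q hq)]
      simp only [map_add, map_mul]
  | mul x y _ _ ihx ihy =>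
    obtain ⟨f, p, hp, hf, rfl⟩ := ihx
    obtain ⟨g, q, hq, hg, rfl⟩ := ihy
    refine ⟨f * g, p * q, fun t => by simp [hp t, hq t], ?_, ?_⟩
    · rw [Polynomial.natDegree_mul (nz p hp) (nz q hq)]
      exact Polynomial.natDegree_mul_le.trans (by omega)
    · rw [div_mul_div_comm, map_mul, map_mul]

noncomputable def phi : MvPolynomial (Fin 2) ℝ →+* DD :=
  MvPolynomial.eval₂Hom ((algebraMap ℝ (RatFunc ℝ)).codRestrict DD const_mem)
    ![⟨_, gen_mem (algebraMap ℝ[X] (RatFunc ℝ) X)⟩, ⟨_, lin_mem (algebraMap ℝ[X] (RatFunc ℝ) X)⟩]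

theorem mono_range (d : ℕ) : ∀ k ≤ 2 * d, (algebraMap ℝ[X] (RatFunc ℝ) X) ^ k /
    (1 + (algebraMap ℝ[X] (RatFunc ℝ) X) ^ 2) ^ d ∈ (DD.subtype.comp phi).range := by
  have hu : (1 + (algebraMap ℝ[X] (RatFunc ℝ) X) ^ 2)⁻¹ ∈ (DD.subtype.comp phi).range :=
    ⟨MvPolynomial.X 0, by simp [phi]⟩
  have hv : (algebraMap ℝ[X] (RatFunc ℝ) X) * (1 + (algebraMap ℝ[X] (RatFunc ℝ) X) ^ 2)⁻¹ ∈
      (DD.subtype.comp phi).range := ⟨MvPolynomial.X 1, by simp [phi]⟩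
  have h0 := one_add_sq_ne (algebraMap ℝ[X] (RatFunc ℝ) X)
  generalize algebraMap ℝ[X] (RatFunc ℝ) X = x at *
  induction d with
  | zero => intro k hk; obtain rfl : k = 0 := by omega
            simp only [pow_zero, div_one]; exact one_mem _
  | succ d ih =>
    intro k hk
    by_cases h1 : k ≤ 2 * d
    · convert mul_mem (ih k h1) hu using 1
      field_simp
      ring
    by_cases h2 : k = 2 * d + 1
    · subst h2
      convert mul_mem (ih (2 * d) le_rfl) hv using 1
      field_simp
      ring
    obtain rfl : k = 2 * d + 2 := by omega
    convert mul_mem (ih (2 * d) le_rfl) (sub_mem (one_mem _) hu) using 1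
    field_simp
    ring

theorem poly_range (d : ℕ) (f : ℝ[X]) (hf : f.natDegree ≤ 2 * d) :
    algebraMap ℝ[X] (RatFunc ℝ) f /
    (1 + (algebraMap ℝ[X] (RatFunc ℝ) X) ^ 2) ^ d ∈ (DD.subtype.comp phi).range := by
  have eqf := Polynomial.as_sum_range_C_mul_X_pow' f (n := 2 * d + 1) (by omega)
  rw [eqf, map_sum, Finset.sum_div]
  refine sum_mem fun k hk => ?_
  rw [map_mul, map_pow, mul_div_assoc]
  refine mul_mem ⟨MvPolynomial.C (f.coeff k), ?_⟩ (mono_range d k ?_)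
  · simp [phi]
  · have := Finset.mem_range.1 hk
    omega

theorem exists_assoc (x : DD) : ∃ a, Associated (phi a) x := by
  obtain ⟨x, hx⟩ := x
  obtain ⟨f, p, hp, hf, rfl⟩ := exists_frac x hx
  have hp0 : p ≠ 0 := by rintro rfl; exact hp 0 (by simp)
  have hp' : algebraMap ℝ[X] (RatFunc ℝ) p ≠ 0 := RatFunc.algebraMap_ne_zero hp0
  have h0 := one_add_sq_ne (algebraMap ℝ[X] (RatFunc ℝ) X)
  set d := p.natDegree with hd
  obtain ⟨a, ha⟩ := poly_range d (f * p) (Polynomial.natDegree_mul_le.trans (by omega))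
  have hw : (1 + X ^ 2 : ℝ[X]).natDegree = 2 := by
    rw [add_comm]; exact Polynomial.natDegree_X_pow_add_C (r := (1 : ℝ)) (n := 2)
  have hwd : ((1 + X ^ 2 : ℝ[X]) ^ d).natDegree = 2 * d := by
    rw [Polynomial.natDegree_pow, hw, mul_comm]
  have hpd : (p ^ 2).natDegree = 2 * d := by rw [Polynomial.natDegree_pow]
  have m1 := frac_mem _ ((1 + X ^ 2 : ℝ[X]) ^ d) (p ^ 2) rfl
    (fun t => by simpa using hp t) (by omega)
  have m2 := frac_mem _ (p ^ 2) ((1 + X ^ 2 : ℝ[X]) ^ d) rfl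
    (fun t => by
      simp only [eval_pow, eval_add, eval_one, eval_X]
      positivity) (by omega)
  simp only [map_pow, map_add, map_one] at m1 m2
  refine ⟨a, ⟨⟨_, m1⟩, ⟨_, m2⟩, ?_, ?_⟩, ?_⟩
  · apply Subtype.ext
    simp only [Subring.coe_mul, Subring.coe_one]
    field_simp
  · apply Subtype.ext
    simp only [Subring.coe_mul, Subring.coe_one]
    field_simp
  · apply Subtype.ext
    have ha' : ((phi a : DD) : RatFunc ℝ) = _ := ha
    simp only [Subring.coe_mul, ha', map_mul]
    field_simp

theorem noeth : IsNoetherianRing DD := by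
  have hmono : StrictMono (fun I : Ideal DD => I.comap phi) := by
    refine Monotone.strictMono_of_injective (fun I J h => Ideal.comap_mono h) ?_
    intro I J h
    ext x
    obtain ⟨a, ha⟩ := exists_assoc x
    have h1 : a ∈ I.comap phi ↔ a ∈ J.comap phi := by
      have h : I.comap phi = J.comap phi := h
      rw [h]
    rw [Ideal.mem_comap, Ideal.mem_comap] at h1
    have h2 : ∀ L : Ideal DD, phi a ∈ L ↔ x ∈ L := fun L =>
      ⟨fun h => L.mem_of_dvd ha.dvd h, fun h => L.mem_of_dvd ha.symm.dvd h⟩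
    rw [← h2, ← h2, h1]
  rw [isNoetherianRing_iff, isNoetherian_iff]
  have := (isNoetherian_iff.1 (isNoetherianRing_iff.1
    (inferInstance : IsNoetherianRing (MvPolynomial (Fin 2) ℝ))))
  exact Subrelation.wf (fun {a b} h => hmono h) (InvImage.wf (fun I : Ideal DD => I.comap phi) this)

theorem key_elts (a b : DD) : ∃ e w v : DD, a * w = b * e ∧ b * w = a * v ∧ e + v = 1 := by
  by_cases hb : b = 0
  · exact ⟨1, 0, 0, by simp [hb], by simp [hb], by simp⟩
  have hb' : (b : RatFunc ℝ) ≠ 0 := fun h => hb (Subtype.ext h)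
  have h0 := one_add_sq_ne ((a : RatFunc ℝ) / b)
  refine ⟨1 - ⟨_, gen_mem ((a : RatFunc ℝ) / b)⟩, ⟨_, lin_mem ((a : RatFunc ℝ) / b)⟩,
    ⟨_, gen_mem ((a : RatFunc ℝ) / b)⟩, ?_, ?_, by ring⟩
  · apply Subtype.ext
    simp only [Subring.coe_mul, AddSubgroupClass.coe_sub, Subring.coe_one]
    obtain ⟨y, hy⟩ : ∃ y : RatFunc ℝ, (a : RatFunc ℝ) = y * b := ⟨a / b, by field_simp⟩
    rw [hy, mul_div_cancel_right₀ _ hb']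
    have h1 := one_add_sq_ne y
    field_simp
    ring
  · apply Subtype.ext
    simp only [Subring.coe_mul]
    obtain ⟨y, hy⟩ : ∃ y : RatFunc ℝ, (a : RatFunc ℝ) = y * b := ⟨a / b, by field_simp⟩
    rw [hy, mul_div_cancel_right₀ _ hb']
    ring

theorem val_ring (P : Ideal DD) [P.IsPrime] : ValuationRing (Localization.AtPrime P) := by
  have hdom : IsDomain (Localization.AtPrime P) :=
    IsLocalization.isDomain_localization P.primeCompl_le_nonZeroDivisors
  refine { cond' := fun x y => ?_ }
  obtain ⟨a, s, rfl⟩ := IsLocalization.exists_mk'_eq P.primeCompl x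
  obtain ⟨b, t, rfl⟩ := IsLocalization.exists_mk'_eq P.primeCompl y
  have main : ∀ (a b : DD) (s t : P.primeCompl) (e w : DD), a * w = b * e → e ∉ P →
      ∃ c, IsLocalization.mk' (Localization.AtPrime P) a s * c = IsLocalization.mk' _ b t := by
    intro a b s t e w h he
    refine ⟨IsLocalization.mk' _ (w * s) (⟨e, he⟩ * t), ?_⟩
    rw [← IsLocalization.mk'_mul, IsLocalization.mk'_eq_iff_eq]
    congr 1
    simp only [Submonoid.coe_mul]
    linear_combination (s * t : DD) * h
  obtain ⟨e, w, v, h1, h2, h3⟩ := key_elts a b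
  by_cases he : e ∈ P
  · have hv : v ∉ P := fun hv => (Ideal.ne_top_iff_one P).1 (Ideal.IsPrime.ne_top inferInstance)
      (h3 ▸ P.add_mem he hv)
    obtain ⟨c, hc⟩ := main b a t s v w h2 hv
    exact ⟨c, Or.inr hc⟩
  · obtain ⟨c, hc⟩ := main a b s t e w h1 he
    exact ⟨c, Or.inl hc⟩

/-- The minimal Dress ring of `ℝ(X)` is a Dedekind domain. -/
theorem minimalDressRing_ratFunc_isDedekindDomain :
    IsDedekindDomain
      ↥(Subring.closure {s : RatFunc ℝ | ∃ x : RatFunc ℝ, s = (1 + x ^ 2)⁻¹}) := by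
  have := noeth
  have : IsDedekindDomainDvr DD := by
    refine { (isNoetherianRing_iff.1 noeth) with is_dvr_at_nonzero_prime := fun P hP hPp => ?_ }
    have : IsNoetherianRing (Localization.AtPrime P) :=
      IsLocalization.isNoetherianRing P.primeCompl _ noeth
    have hdom : IsDomain (Localization.AtPrime P) :=
      IsLocalization.isDomain_localization P.primeCompl_le_nonZeroDivisors
    have hf : ¬ IsField (Localization.AtPrime P) :=
      IsLocalization.AtPrime.not_isField DD hP _
    exact ((IsDiscreteValuationRing.TFAE _ hf).out 0 1).2 (val_ring P)
  exact IsDedekindDomainDvr.isDedekindDomain DD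
end

section
/- Let D be the minimal Dress ring of ℝ(X). Let f, g be nonzero real polynomials and γ a real polynomial without real roots, with deg f ≤ deg γ and deg g ≤ deg γ (so that f/γ and g/γ lie in D). Let M = gcd(f, g), and write f = M·f', g = M·g'. Then the ideal of D generated by f/γ and g/γ is NOT principal if and only if max(deg f', deg g') is odd. -/
open Polynomial in
theorem dress_factor (s : ℝ[X]) (hs : ∀ t : ℝ, s.eval t ≠ 0) (hd : 0 < s.natDegree) :
    ∃ q u : ℝ[X], s = q * u ∧ q.natDegree = 2 ∧ (∀ t : ℝ, q.eval t ≠ 0) ∧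
      (∀ t : ℝ, u.eval t ≠ 0) ∧ s.natDegree = u.natDegree + 2 := by
  have hs0 : s ≠ 0 := by rintro rfl; simp at hd
  obtain ⟨q, hq, u, rfl⟩ := WfDvdMonoid.exists_irreducible_factor
    (fun h => by rw [natDegree_eq_zero_of_isUnit h] at hd; exact lt_irrefl _ hd) hs0
  have hq0 : q ≠ 0 := hq.ne_zero
  have hu0 : u ≠ 0 := right_ne_zero_of_mul hs0
  have h1 : ∀ t : ℝ, q.eval t ≠ 0 := fun t h => hs t (by simp [h])
  have h2 : ∀ t : ℝ, u.eval t ≠ 0 := fun t h => hs t (by simp [h])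
  have hle : q.natDegree ≤ 2 := natDegree_le_of_degree_le hq.degree_le_two
  have hpos : 0 < q.natDegree := hq.natDegree_pos
  have hne : q.natDegree ≠ 1 := by
    intro h
    obtain ⟨t, ht⟩ := exists_root_of_degree_eq_one ((degree_eq_iff_natDegree_eq hq0).2 h)
    exact h1 t ht
  have h : q.natDegree = 2 := by omega
  exact ⟨q, u, rfl, h, h1, h2, by rw [natDegree_mul hq0 hu0, h, add_comm]⟩

open Polynomial in
theorem dress_even (n : ℕ) : ∀ s : ℝ[X], s.natDegree = n → (∀ t : ℝ, s.eval t ≠ 0) → Even n := by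
  induction n using Nat.strong_induction_on with
  | _ n ih =>
    intro s hn hs
    rcases Nat.eq_zero_or_pos n with h | h
    · simp [h]
    · obtain ⟨q, u, -, -, -, hu, hd⟩ := dress_factor s hs (hn ▸ h)
      have := ih u.natDegree (by omega) u rfl hu
      rw [← hn, hd]
      exact this.add (by decide)

open Polynomial in
theorem dress_sq_deg (a b : ℝ[X]) :
    2 * max a.natDegree b.natDegree ≤ (a ^ 2 + b ^ 2).natDegree := by
  rcases Nat.eq_zero_or_pos (max a.natDegree b.natDegree) with h | h
  · simp [h]
  apply le_natDegree_of_ne_zero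
  rw [coeff_add, coeff_pow_of_natDegree_le (le_max_left _ _),
    coeff_pow_of_natDegree_le (le_max_right _ _)]
  intro h0
  have ha : a.coeff (max a.natDegree b.natDegree) = 0 := by nlinarith [sq_nonneg (a.coeff (max a.natDegree b.natDegree)), sq_nonneg (b.coeff (max a.natDegree b.natDegree))]
  have hb : b.coeff (max a.natDegree b.natDegree) = 0 := by nlinarith [sq_nonneg (a.coeff (max a.natDegree b.natDegree)), sq_nonneg (b.coeff (max a.natDegree b.natDegree))]
  rcases le_total a.natDegree b.natDegree with h1 | h1
  · rw [max_eq_right h1] at hb h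
    have : b = 0 := leadingCoeff_eq_zero.1 hb
    simp [this] at h
  · rw [max_eq_left h1] at ha h
    have : a = 0 := leadingCoeff_eq_zero.1 ha
    simp [this] at h

open Polynomial in
theorem dress_sq_root (a b : ℝ[X]) (h : IsCoprime a b) (t : ℝ) : (a ^ 2 + b ^ 2).eval t ≠ 0 := by
  intro h0
  obtain ⟨u, v, huv⟩ := h
  have h1 := congrArg (eval t) huv
  simp only [eval_add, eval_mul, eval_pow, eval_one] at h1 h0
  have ha : a.eval t = 0 := by nlinarith [sq_nonneg (a.eval t), sq_nonneg (b.eval t)]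
  have hb : b.eval t = 0 := by nlinarith [sq_nonneg (a.eval t), sq_nonneg (b.eval t)]
  simp [ha, hb] at h1

theorem dress_ne (s : Polynomial ℝ) (hs : ∀ t : ℝ, s.eval t ≠ 0) :
    s ≠ 0 := by
  rintro rfl; exact hs 0 (by simp)

open Polynomial in
theorem dress_repr (r : RatFunc ℝ)
    (hr : r ∈ Subring.closure {s : RatFunc ℝ | ∃ x : RatFunc ℝ, s = (1 + x ^ 2)⁻¹}) :
    ∃ n s : ℝ[X], (∀ t : ℝ, s.eval t ≠ 0) ∧ n.natDegree ≤ s.natDegree ∧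
      r = algebraMap ℝ[X] (RatFunc ℝ) n / algebraMap ℝ[X] (RatFunc ℝ) s := by
  induction hr using Subring.closure_induction with
  | mem r hr =>
    obtain ⟨x, rfl⟩ := hr
    have hd : algebraMap ℝ[X] (RatFunc ℝ) x.denom ≠ 0 := by
      simpa using x.denom_ne_zero
    refine ⟨x.denom ^ 2, x.denom ^ 2 + x.num ^ 2,
      dress_sq_root _ _ x.isCoprime_num_denom.symm, ?_, ?_⟩
    · rw [natDegree_pow]
      exact le_trans (by gcongr; exact le_max_left _ _) (dress_sq_deg x.denom x.num)
    · conv_lhs => rw [← x.num_div_denom]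
      rw [map_add, map_pow, map_pow, div_pow, ← inv_div]
      field_simp
  | zero => exact ⟨0, 1, by simp, by simp, by simp⟩
  | one => exact ⟨1, 1, by simp, by simp, by simp⟩
  | add x y _ _ hx hy =>
    obtain ⟨n, s, hs, hd, rfl⟩ := hx
    obtain ⟨n', s', hs', hd', rfl⟩ := hy
    have h0 := dress_ne s hs
    have h0' := dress_ne s' hs'
    have k0 : algebraMap ℝ[X] (RatFunc ℝ) s ≠ 0 := by simpa using h0
    have k0' : algebraMap ℝ[X] (RatFunc ℝ) s' ≠ 0 := by simpa using h0'
    refine ⟨n * s' + n' * s, s * s', fun t => by simp [hs t, hs' t], ?_, ?_⟩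
    · rw [natDegree_mul h0 h0']
      refine natDegree_add_le_of_degree_le (natDegree_mul_le.trans ?_) (natDegree_mul_le.trans ?_)
      <;> omega
    · simp only [map_add, map_mul]
      field_simp
  | neg x _ hx =>
    obtain ⟨n, s, hs, hd, rfl⟩ := hx
    exact ⟨-n, s, hs, by simpa using hd, by simp [neg_div]⟩
  | mul x y _ _ hx hy =>
    obtain ⟨n, s, hs, hd, rfl⟩ := hx
    obtain ⟨n', s', hs', hd', rfl⟩ := hy
    have h0 := dress_ne s hs
    have h0' := dress_ne s' hs'
    refine ⟨n * n', s * s', fun t => by simp [hs t, hs' t], ?_, ?_⟩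
    · rw [natDegree_mul h0 h0']
      exact natDegree_mul_le.trans (add_le_add hd hd')
    · simp only [map_mul]
      rw [div_mul_div_comm]

open Polynomial in
theorem dress_repr₂ (a b : RatFunc ℝ)
    (ha : a ∈ Subring.closure {s : RatFunc ℝ | ∃ x : RatFunc ℝ, s = (1 + x ^ 2)⁻¹})
    (hb : b ∈ Subring.closure {s : RatFunc ℝ | ∃ x : RatFunc ℝ, s = (1 + x ^ 2)⁻¹}) :
    ∃ m n s : ℝ[X], (∀ t : ℝ, s.eval t ≠ 0) ∧ m.natDegree ≤ s.natDegree ∧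
      n.natDegree ≤ s.natDegree ∧
      a = algebraMap ℝ[X] (RatFunc ℝ) m / algebraMap ℝ[X] (RatFunc ℝ) s ∧
      b = algebraMap ℝ[X] (RatFunc ℝ) n / algebraMap ℝ[X] (RatFunc ℝ) s := by
  obtain ⟨n, s, hs, hd, rfl⟩ := dress_repr a ha
  obtain ⟨n', s', hs', hd', rfl⟩ := dress_repr b hb
  have h0 := dress_ne s hs
  have h0' := dress_ne s' hs'
  have k0 : algebraMap ℝ[X] (RatFunc ℝ) s ≠ 0 := by simpa using h0
  have k0' : algebraMap ℝ[X] (RatFunc ℝ) s' ≠ 0 := by simpa using h0'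
  refine ⟨n * s', n' * s, s * s', fun t => by simp [hs t, hs' t], ?_, ?_, ?_, ?_⟩
  · rw [natDegree_mul h0 h0']
    exact natDegree_mul_le.trans (by omega)
  · rw [natDegree_mul h0 h0']
    exact natDegree_mul_le.trans (by omega)
  · simp only [map_mul]
    field_simp
  · simp only [map_mul]
    field_simp

open Polynomial in
theorem dress_const (r : ℝ) : algebraMap ℝ[X] (RatFunc ℝ) (C r) ∈
    Subring.closure {s : RatFunc ℝ | ∃ x : RatFunc ℝ, s = (1 + x ^ 2)⁻¹} := by
  have key : ∀ r : ℝ, 0 ≤ r → r < 1 → algebraMap ℝ[X] (RatFunc ℝ) (C r) ∈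
      Subring.closure {s : RatFunc ℝ | ∃ x : RatFunc ℝ, s = (1 + x ^ 2)⁻¹} := by
    intro r h0 h1
    rcases h0.eq_or_lt with rfl | h0
    · simp
    apply Subring.subset_closure
    refine ⟨algebraMap ℝ[X] (RatFunc ℝ) (C (Real.sqrt (r⁻¹ - 1))), ?_⟩
    have h2 : 0 ≤ r⁻¹ - 1 := by
      have := (one_lt_inv₀ h0).2 h1
      linarith
    apply eq_inv_of_mul_eq_one_left
    rw [← map_pow, ← map_one (algebraMap ℝ[X] (RatFunc ℝ)), ← map_add, ← map_mul, ← C_pow,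
      Real.sq_sqrt h2, ← C_1, ← C_add, ← C_mul]
    congr 2
    field_simp
    ring
  have : algebraMap ℝ[X] (RatFunc ℝ) (C r) =
      ((⌊r⌋ : ℤ) : RatFunc ℝ) + algebraMap ℝ[X] (RatFunc ℝ) (C (Int.fract r)) := by
    conv_lhs => rw [← Int.floor_add_fract r]
    rw [C_add, map_add]
    congr 1
    simp
  rw [this]
  exact add_mem (intCast_mem _ _) (key _ (Int.fract_nonneg r) (Int.fract_lt_one r))

open Polynomial in
theorem dress_half (x : RatFunc ℝ) (hx : 1 + x ^ 2 ≠ 0) : x * (1 + x ^ 2)⁻¹ ∈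
    Subring.closure {s : RatFunc ℝ | ∃ x : RatFunc ℝ, s = (1 + x ^ 2)⁻¹} := by
  have hh : ((2 : RatFunc ℝ)⁻¹) ∈
      Subring.closure {s : RatFunc ℝ | ∃ x : RatFunc ℝ, s = (1 + x ^ 2)⁻¹} := 
    Subring.subset_closure ⟨1, by norm_num⟩
  by_cases h : 1 + x = 0
  · have : x = -1 := by linear_combination h
    subst this
    convert neg_mem hh using 1
    norm_num
  · have h2 : ((1 + ((1 - x) / (1 + x)) ^ 2)⁻¹ : RatFunc ℝ) ∈
      Subring.closure {s : RatFunc ℝ | ∃ x : RatFunc ℝ, s = (1 + x ^ 2)⁻¹} := 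
      Subring.subset_closure ⟨_, rfl⟩
    have e : (1 + ((1 - x) / (1 + x)) ^ 2)⁻¹ = (2:RatFunc ℝ)⁻¹ + x * (1 + x ^ 2)⁻¹ := by
      apply inv_eq_of_mul_eq_one_right
      field_simp
      ring
    have := sub_mem h2 hh
    rw [e] at this
    simpa using this

open Polynomial in
theorem dress_quad (q : ℝ[X]) (hq : q.natDegree = 2) (h : ∀ t : ℝ, q.eval t ≠ 0) (n : ℝ[X])
    (hn : n.natDegree ≤ 2) :
    algebraMap ℝ[X] (RatFunc ℝ) n / algebraMap ℝ[X] (RatFunc ℝ) q ∈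
    Subring.closure {s : RatFunc ℝ | ∃ x : RatFunc ℝ, s = (1 + x ^ 2)⁻¹} := by
  obtain ⟨a, b, c, hqe⟩ : ∃ a b c : ℝ, q = C a * X ^ 2 + C b * X + C c :=
    ⟨_, _, _, eq_quadratic_of_degree_le_two (degree_le_of_natDegree_le hq.le)⟩
  obtain ⟨k, l, m, hne⟩ : ∃ a b c : ℝ, n = C a * X ^ 2 + C b * X + C c :=
    ⟨_, _, _, eq_quadratic_of_degree_le_two (degree_le_of_natDegree_le hn)⟩
  have ha : a ≠ 0 := by
    rintro rfl
    have : q.natDegree ≤ 1 := by rw [hqe]; simp only [C_0, zero_mul, zero_add]; exact natDegree_linear_le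
    omega
  have hD : 0 < 4 * a * c - b ^ 2 := by
    by_contra hneg
    push Not at hneg
    apply h ((-b + Real.sqrt (b ^ 2 - 4 * a * c)) / (2 * a))
    rw [hqe]
    have := Real.sq_sqrt (show 0 ≤ b ^ 2 - 4 * a * c by linarith)
    simp only [eval_add, eval_mul, eval_C, eval_pow, eval_X]
    field_simp
    ring_nf
    ring_nf at this
    rw [this]
    ring
  obtain ⟨d, hd0, hd⟩ : ∃ d : ℝ, d ≠ 0 ∧ d ^ 2 = 4 * a * c - b ^ 2 :=
    ⟨_, (Real.sqrt_pos.2 hD).ne', Real.sq_sqrt hD.le⟩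
  have hq0 : q ≠ 0 := dress_ne q h
  set κ : ℝ →+* RatFunc ℝ := (algebraMap ℝ[X] (RatFunc ℝ)).comp C with hκ
  have hκm : ∀ r, κ r ∈ Subring.closure {s : RatFunc ℝ | ∃ x : RatFunc ℝ, s = (1 + x ^ 2)⁻¹} :=
    dress_const
  have hκ0 : ∀ r, r ≠ 0 → κ r ≠ 0 := fun r hr => by simpa using hr
  obtain ⟨Y, hY⟩ : ∃ Y, Y = algebraMap ℝ[X] (RatFunc ℝ) X := ⟨_, rfl⟩
  have hqA : algebraMap ℝ[X] (RatFunc ℝ) q = κ a * Y ^ 2 + κ b * Y + κ c := by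
    rw [hqe, hY]; simp [hκ]
  have hnA : algebraMap ℝ[X] (RatFunc ℝ) n = κ k * Y ^ 2 + κ l * Y + κ m := by
    rw [hne, hY]; simp [hκ]
  have hqA0 : algebraMap ℝ[X] (RatFunc ℝ) q ≠ 0 := by simpa using hq0
  rw [hqA] at hqA0
  rw [hqA, hnA]
  clear_value κ
  have hdκ : κ d ^ 2 = 4 * κ a * κ c - κ b ^ 2 := by
    rw [← map_pow, hd]; simp only [map_sub, map_mul, map_pow, map_ofNat]
  have ka := hκ0 a ha
  have kd := hκ0 d hd0
  obtain ⟨x, hx⟩ : ∃ x, x = (2 * κ a * Y + κ b) / κ d := ⟨_, rfl⟩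
  have e1 : 1 + x ^ 2 = κ (4 * a / d ^ 2) * (κ a * Y ^ 2 + κ b * Y + κ c) := by
    rw [hx]
    simp only [map_div₀, map_mul, map_pow, map_ofNat]
    field_simp
    linear_combination hdκ
  have hx0 : 1 + x ^ 2 ≠ 0 := by
    rw [e1]
    exact mul_ne_zero (hκ0 _ (by positivity)) hqA0
  have e2 : (κ a * Y ^ 2 + κ b * Y + κ c)⁻¹ = κ (4 * a / d ^ 2) * (1 + x ^ 2)⁻¹ := by
    rw [e1, mul_inv, mul_inv_cancel_left₀ (hκ0 _ (by positivity))]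
  have e3 : Y = κ (d / (2 * a)) * x - κ (b / (2 * a)) := by
    rw [hx]
    simp only [map_div₀, map_mul, map_ofNat]
    field_simp
    ring
  have m0 : (1 + x ^ 2)⁻¹ ∈ Subring.closure {s : RatFunc ℝ | ∃ x : RatFunc ℝ, s = (1 + x ^ 2)⁻¹} :=
    Subring.subset_closure ⟨_, rfl⟩
  have m1 := dress_half x hx0
  have m2 := sub_mem (one_mem _) m0
  have e4 : x ^ 2 * (1 + x ^ 2)⁻¹ = 1 - (1 + x ^ 2)⁻¹ := by
    field_simp
    ring
  rw [div_eq_mul_inv, e2]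
  generalize (1 + x ^ 2)⁻¹ = z at *
  have hw := hκm (4 * a / d ^ 2)
  generalize κ (4 * a / d ^ 2) = w at *
  have p1 := hκm (d / (2 * a))
  have p2 := hκm (b / (2 * a))
  generalize κ (d / (2 * a)) = u at *
  generalize κ (b / (2 * a)) = v at *
  have hz1 : Y * z ∈ Subring.closure {s : RatFunc ℝ | ∃ x : RatFunc ℝ, s = (1 + x ^ 2)⁻¹} := by
    have : Y * z = u * (x * z) - v * z := by rw [e3]; ring
    rw [this]
    exact sub_mem (mul_mem p1 m1) (mul_mem p2 m0)
  have hz2 : Y ^ 2 * z ∈ Subring.closure {s : RatFunc ℝ | ∃ x : RatFunc ℝ, s = (1 + x ^ 2)⁻¹} := by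
    have : Y ^ 2 * z = u * u * (1 - z) - (u * v + u * v) * (x * z) + v * v * z := by
      rw [← e4, e3]; ring
    rw [this]
    exact add_mem (sub_mem (mul_mem (mul_mem p1 p1) m2)
      (mul_mem (add_mem (mul_mem p1 p2) (mul_mem p1 p2)) m1)) (mul_mem (mul_mem p2 p2) m0)
  have : (κ k * Y ^ 2 + κ l * Y + κ m) * (w * z) =
      w * (κ k * (Y ^ 2 * z) + κ l * (Y * z) + κ m * z) := by ring
  rw [this]
  exact mul_mem hw (add_mem (add_mem (mul_mem (hκm _) hz2) (mul_mem (hκm _) hz1))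
    (mul_mem (hκm _) m0))

open Polynomial in
theorem dress_mem (k : ℕ) : ∀ n s : ℝ[X], s.natDegree = k → (∀ t : ℝ, s.eval t ≠ 0) →
    n.natDegree ≤ s.natDegree →
    algebraMap ℝ[X] (RatFunc ℝ) n / algebraMap ℝ[X] (RatFunc ℝ) s ∈
    Subring.closure {s : RatFunc ℝ | ∃ x : RatFunc ℝ, s = (1 + x ^ 2)⁻¹} := by
  induction k using Nat.strong_induction_on with
  | _ k ih =>
    intro n s hk hs hn
    rcases Nat.eq_zero_or_pos k with h | h
    · rw [eq_C_of_natDegree_eq_zero (hk.trans h),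
        eq_C_of_natDegree_eq_zero (Nat.le_zero.1 (hn.trans (hk.trans h).le))]
      have := dress_const (n.coeff 0 / s.coeff 0)
      simpa using this
    · obtain ⟨q, u, rfl, hq2, hq, hu, hd⟩ := dress_factor s hs (hk ▸ h)
      have hu0 := dress_ne u hu
      have hq0 := dress_ne q hq
      have ku0 : algebraMap ℝ[X] (RatFunc ℝ) u ≠ 0 := by simpa using hu0
      have kq0 : algebraMap ℝ[X] (RatFunc ℝ) q ≠ 0 := by simpa using hq0
      have e : u * (n / u) + n % u = n := EuclideanDomain.div_add_mod n u
      have hB : (n % u).natDegree ≤ u.natDegree :=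
        natDegree_le_natDegree (degree_mod_lt n hu0).le
      have hA : (n / u).natDegree ≤ 2 := by
        by_cases hz : n / u = 0
        · simp [hz]
        have h1 : u * (n / u) = n - n % u := by linear_combination e
        have h2 := congrArg natDegree h1
        rw [natDegree_mul hu0 hz] at h2
        have h3 := natDegree_sub_le n (n % u)
        omega
      have : algebraMap ℝ[X] (RatFunc ℝ) n / algebraMap ℝ[X] (RatFunc ℝ) (q * u) =
          algebraMap ℝ[X] (RatFunc ℝ) (n / u) / algebraMap ℝ[X] (RatFunc ℝ) q +
          (algebraMap ℝ[X] (RatFunc ℝ) 1 / algebraMap ℝ[X] (RatFunc ℝ) q) *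
          (algebraMap ℝ[X] (RatFunc ℝ) (n % u) / algebraMap ℝ[X] (RatFunc ℝ) u) := by
        conv_lhs => rw [← e]
        simp only [map_add, map_mul, map_one]
        field_simp
      rw [this]
      exact add_mem (dress_quad q hq2 hq _ hA) (mul_mem (dress_quad q hq2 hq _ (by simp))
        (ih u.natDegree (by omega) _ u rfl hu hB))


/-- Let `D` be the minimal Dress ring of `ℝ(X)`, `f, g` nonzero real
polynomials and `γ` a real polynomial without real roots with `deg f, deg g ≤ deg γ`, so
that `p = f/γ` and `q = g/γ` lie in `D`.  Writing `f = gcd(f,g)·f'` and `g = gcd(f,g)·g'`,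
the ideal `(p, q)` of `D` is not principal iff `max(deg f', deg g')` is odd. -/
theorem minimalDressRing_span_pair_not_principal_iff
    (f g γ f' g' : Polynomial ℝ) (hf : f ≠ 0) (hg : g ≠ 0)
    (hγ : ∀ t : ℝ, γ.eval t ≠ 0)
    (hdf : f.degree ≤ γ.degree) (hdg : g.degree ≤ γ.degree)
    (hf' : f = EuclideanDomain.gcd f g * f') (hg' : g = EuclideanDomain.gcd f g * g')
    (hp : algebraMap (Polynomial ℝ) (RatFunc ℝ) f / algebraMap (Polynomial ℝ) (RatFunc ℝ) γ
      ∈ Subring.closure {s : RatFunc ℝ | ∃ x : RatFunc ℝ, s = (1 + x ^ 2)⁻¹})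
    (hq : algebraMap (Polynomial ℝ) (RatFunc ℝ) g / algebraMap (Polynomial ℝ) (RatFunc ℝ) γ
      ∈ Subring.closure {s : RatFunc ℝ | ∃ x : RatFunc ℝ, s = (1 + x ^ 2)⁻¹}) :
    ¬ (Ideal.span {(⟨_, hp⟩ :
          ↥(Subring.closure {s : RatFunc ℝ | ∃ x : RatFunc ℝ, s = (1 + x ^ 2)⁻¹})),
        ⟨_, hq⟩}).IsPrincipal ↔
      Odd (max f'.natDegree g'.natDegree) := by
  set K := Subring.closure {s : RatFunc ℝ | ∃ x : RatFunc ℝ, s = (1 + x ^ 2)⁻¹} with hK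
  have hM0 : EuclideanDomain.gcd f g ≠ 0 := fun h => hf (by rw [hf', h, zero_mul])
  have hf0 : f' ≠ 0 := fun h => hf (by rw [hf', h, mul_zero])
  have hcop : IsCoprime f' g' := by
    have e := EuclideanDomain.gcd_eq_gcd_ab f g
    refine ⟨EuclideanDomain.gcdA f g, EuclideanDomain.gcdB f g, mul_left_cancel₀ hM0 ?_⟩
    linear_combination (-EuclideanDomain.gcdA f g) * hf' - EuclideanDomain.gcdB f g * hg' - e
  generalize EuclideanDomain.gcd f g = M at hf' hg' hM0
  have hγ0 := dress_ne γ hγ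
  set A := algebraMap (Polynomial ℝ) (RatFunc ℝ) with hA
  have hAi : ∀ a b, A a = A b → a = b := fun a b h => RatFunc.algebraMap_injective ℝ h
  have hA0 : ∀ a, a ≠ 0 → A a ≠ 0 := fun a h h' => h (hAi _ _ (by simpa using h'))
  have kM := hA0 _ hM0
  have kγ := hA0 _ hγ0
  have kf := hA0 _ hf0
  have hfA : A f = A M * A f' := by rw [← map_mul, ← hf']
  have hgA : A g = A M * A g' := by rw [← map_mul, ← hg']
  constructor
  · intro hnp
    by_contra hodd
    rw [Nat.not_odd_iff_even] at hodd
    apply hnp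
    obtain ⟨k, hk⟩ := hodd
    have hδ : ∀ t : ℝ, ((1 + Polynomial.X ^ 2 : Polynomial ℝ) ^ k).eval t ≠ 0 := by
      intro t
      simp only [Polynomial.eval_pow, Polynomial.eval_add, Polynomial.eval_one, Polynomial.eval_X]
      positivity
    have hδd : ((1 + Polynomial.X ^ 2 : Polynomial ℝ) ^ k).natDegree = k + k := by
      rw [Polynomial.natDegree_pow]
      have : (1 + Polynomial.X ^ 2 : Polynomial ℝ).natDegree = 2 := by compute_degree!
      rw [this]; ring
    generalize (1 + Polynomial.X ^ 2 : Polynomial ℝ) ^ k = δ at hδ hδd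
    have kδ := hA0 _ (dress_ne δ hδ)
    have hs := dress_sq_root f' g' hcop
    have hsd := dress_sq_deg f' g'
    have ks := hA0 _ (dress_ne _ hs)
    have hfm := le_max_left f'.natDegree g'.natDegree
    have hgm := le_max_right f'.natDegree g'.natDegree
    have m1 : A f' / A δ ∈ K := dress_mem _ _ _ rfl hδ (by omega)
    have m2 : A g' / A δ ∈ K := dress_mem _ _ _ rfl hδ (by omega)
    have m3 : A (f' * δ) / A (f' ^ 2 + g' ^ 2) ∈ K :=
      dress_mem _ _ _ rfl hs (Polynomial.natDegree_mul_le.trans (by omega))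
    have m4 : A (g' * δ) / A (f' ^ 2 + g' ^ 2) ∈ K :=
      dress_mem _ _ _ rfl hs (Polynomial.natDegree_mul_le.trans (by omega))
    have ks' : A f' ^ 2 + A g' ^ 2 ≠ 0 := by simpa using ks
    have eh : A (f' * δ) / A (f' ^ 2 + g' ^ 2) * (A f / A γ) +
        A (g' * δ) / A (f' ^ 2 + g' ^ 2) * (A g / A γ) = A M * A δ / A γ := by
      rw [hfA, hgA]
      simp only [map_add, map_mul, map_pow]
      field_simp
    have hh : A M * A δ / A γ ∈ K := by
      rw [← eh]
      exact add_mem (mul_mem m3 hp) (mul_mem m4 hq)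
    refine ⟨⟨⟨A M * A δ / A γ, hh⟩, ?_⟩⟩
    apply le_antisymm
    · rw [Ideal.span_le]
      rintro y (rfl | rfl)
      · refine Ideal.mem_span_singleton.2 ⟨⟨_, m1⟩, Subtype.ext ?_⟩
        change A f / A γ = A M * A δ / A γ * (A f' / A δ)
        rw [hfA]
        field_simp
      · refine Ideal.mem_span_singleton.2 ⟨⟨_, m2⟩, Subtype.ext ?_⟩
        change A g / A γ = A M * A δ / A γ * (A g' / A δ)
        rw [hgA]
        field_simp
    · refine Ideal.span_le.2 (Set.singleton_subset_iff.2 ?_)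
      exact Ideal.mem_span_pair.2 ⟨⟨_, m3⟩, ⟨_, m4⟩, Subtype.ext eh⟩
  · rintro hodd ⟨⟨h, hh⟩⟩
    rw [Ideal.submodule_span_eq] at hh
    have i1 := hh.le (Ideal.subset_span (Set.mem_insert _ _))
    have i2 := hh.le (Ideal.subset_span (Set.mem_insert_of_mem _ (Set.mem_singleton _)))
    have i3 := hh.ge (Ideal.mem_span_singleton_self h)
    obtain ⟨a, ha⟩ := Ideal.mem_span_singleton.1 i1
    obtain ⟨b, hb⟩ := Ideal.mem_span_singleton.1 i2
    obtain ⟨c, d, hcd⟩ := Ideal.mem_span_pair.1 i3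
    have ha := congrArg Subtype.val ha
    have hb := congrArg Subtype.val hb
    have hcd := congrArg Subtype.val hcd
    simp only [Subring.coe_mul, Subring.coe_add] at ha hb hcd
    obtain ⟨P, Q, v, hv, hPv, hQv, hae, hbe⟩ := dress_repr₂ a b a.2 b.2
    obtain ⟨C, D, w, hw, hCw, hDw, hce, hde⟩ := dress_repr₂ c d c.2 d.2
    have hh0 : (h : RatFunc ℝ) ≠ 0 := by
      intro h0
      rw [h0, zero_mul] at ha
      exact div_ne_zero (hA0 _ hf) kγ ha
    have h1 : (c : RatFunc ℝ) * a + d * b = 1 := by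
      apply mul_left_cancel₀ hh0
      rw [ha, hb] at hcd
      linear_combination hcd
    rw [hae, hfA] at ha
    rw [hbe, hgA] at hb
    rw [hae, hbe, hce, hde] at h1
    have kv := hA0 _ (dress_ne v hv)
    have kw := hA0 _ (dress_ne w hw)
    have r1 : P * g' = Q * f' := by
      apply hAi
      simp only [map_mul]
      change A M * A f' / A γ = h * (A P / A v) at ha
      change A M * A g' / A γ = h * (A Q / A v) at hb
      rw [div_eq_iff kγ] at ha hb
      apply mul_left_cancel₀ kM
      have e1 : A P = A P / A v * A v := (div_mul_cancel₀ _ kv).symm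
      have e2 : A Q = A Q / A v * A v := (div_mul_cancel₀ _ kv).symm
      rw [e1, e2]
      linear_combination (A P / A v * A v) * hb - (A Q / A v * A v) * ha
    have r2 : C * P + D * Q = w * v := by
      apply hAi
      simp only [map_mul, map_add]
      change A C / A w * (A P / A v) + A D / A w * (A Q / A v) = 1 at h1
      field_simp at h1
      linear_combination h1
    obtain ⟨e, rfl⟩ : f' ∣ P := hcop.dvd_of_dvd_mul_right ⟨Q, by rw [r1, mul_comm]⟩
    obtain rfl : Q = g' * e := by
      apply mul_left_cancel₀ hf0
      linear_combination -r1
    have r3 : e * (C * f' + D * g') = w * v := by linear_combination r2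
    have he : ∀ t : ℝ, e.eval t ≠ 0 := by
      intro t ht
      have := congrArg (Polynomial.eval t) r3
      rw [Polynomial.eval_mul, ht, zero_mul, Polynomial.eval_mul] at this
      exact mul_ne_zero (hw t) (hv t) this.symm
    have he0 := dress_ne e he
    have hg0 : g' ≠ 0 := fun h => hg (by rw [hg', h, mul_zero])
    rw [Polynomial.natDegree_mul hf0 he0] at hPv
    rw [Polynomial.natDegree_mul hg0 he0] at hQv
    have d1 := congrArg Polynomial.natDegree r3
    rw [Polynomial.natDegree_mul (dress_ne w hw) (dress_ne v hv)] at d1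
    have d2 : (e * (C * f' + D * g')).natDegree ≤
        e.natDegree + (w.natDegree + max f'.natDegree g'.natDegree) := by
      refine Polynomial.natDegree_mul_le.trans (Nat.add_le_add_left ?_ _)
      refine Polynomial.natDegree_add_le_of_degree_le
        (Polynomial.natDegree_mul_le.trans ?_) (Polynomial.natDegree_mul_le.trans ?_)
      · exact add_le_add hCw (le_max_left _ _)
      · exact add_le_add hDw (le_max_right _ _)
    obtain ⟨x, hx⟩ := dress_even _ e rfl he
    obtain ⟨y, hy⟩ := dress_even _ v rfl hv
    obtain ⟨z, hz⟩ := hodd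
    omega
end

section
/- Let D be the minimal Dress ring of ℝ(X) and let p, q ∈ D. Suppose that either (i) deg p ≥ deg q and q(u) has constant sign on the real roots of p (i.e., q(u) > 0 for every u ∈ ℝ with p(u) = 0, or q(u) < 0 for every such u), or (ii) deg q ≥ deg p and p(z) has constant sign on the real roots of q. Then the 2×2 matrix over D with first row (p, q) and second row (0, 0) is a product of idempotent 2×2 matrices over D. -/
open Polynomial in
theorem dress_of_bdd_degree {f g : ℝ[X]} {c : ℝ} (hg : ∀ x, 0 < g.eval x)
    (h : ∀ x, |f.eval x| ≤ c * g.eval x) : f.natDegree ≤ g.natDegree := by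
  by_contra hlt
  push Not at hlt
  have hg0 : g ≠ 0 := by
    rintro rfl
    simpa using hg 0
  have ht := Polynomial.abs_div_tendsto_atTop_atTop_of_degree_gt f g
    (Polynomial.degree_lt_degree hlt) hg0
  obtain ⟨x, hx⟩ := (ht.eventually (Filter.eventually_gt_atTop c)).exists
  have := h x
  rw [abs_div, abs_of_pos (hg x), lt_div_iff₀ (hg x)] at hx
  linarith

/-- The minimal Dress ring. -/
noncomputable abbrev dressD : Subring (RatFunc ℝ) :=
  Subring.closure {s : RatFunc ℝ | ∃ x : RatFunc ℝ, s = (1 + x ^ 2)⁻¹}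

open Polynomial in
theorem dress_exists_rep {r : RatFunc ℝ} (hr : r ∈ dressD) :
    ∃ (f g : ℝ[X]) (c : ℝ), (∀ x, 0 < g.eval x) ∧ (∀ x, |f.eval x| ≤ c * g.eval x) ∧
      r = algebraMap ℝ[X] (RatFunc ℝ) f / algebraMap ℝ[X] (RatFunc ℝ) g := by
  have hne : ∀ g : ℝ[X], (∀ x, 0 < g.eval x) → algebraMap ℝ[X] (RatFunc ℝ) g ≠ 0 := by
    intro g hg
    apply RatFunc.algebraMap_ne_zero
    rintro rfl
    simpa using hg 0
  induction hr using Subring.closure_induction with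
  | mem x hx =>
    obtain ⟨y, rfl⟩ := hx
    refine ⟨y.denom ^ 2, y.num ^ 2 + y.denom ^ 2, 1, ?_, ?_, ?_⟩
    · intro x
      obtain ⟨a, b, hab⟩ := RatFunc.isCoprime_num_denom y
      have h1 := congrArg (Polynomial.eval x) hab
      simp only [eval_add, eval_mul, eval_one, eval_pow] at h1 ⊢
      by_contra hcon
      have h2 : y.num.eval x = 0 := by nlinarith [sq_nonneg (y.num.eval x), sq_nonneg (y.denom.eval x)]
      have h3 : y.denom.eval x = 0 := by nlinarith [sq_nonneg (y.num.eval x), sq_nonneg (y.denom.eval x)]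
      simp [h2, h3] at h1
    · intro x
      simp only [eval_add, eval_pow, abs_pow, sq_abs]
      nlinarith [sq_nonneg (y.num.eval x)]
    · have hd : algebraMap ℝ[X] (RatFunc ℝ) y.denom ≠ 0 :=
        RatFunc.algebraMap_ne_zero (RatFunc.denom_ne_zero y)
      conv_lhs => rw [← RatFunc.num_div_denom y]
      simp only [map_add, map_pow]
      rw [inv_eq_one_div, div_pow, one_add_div (pow_ne_zero 2 hd), one_div_div, add_comm]
  | zero => exact ⟨0, 1, 0, by simp, by simp, by simp⟩
  | one => exact ⟨1, 1, 1, by simp, by simp, by simp⟩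
  | add x y _ _ hx hy =>
    obtain ⟨f, g, c, h1, h2, rfl⟩ := hx
    obtain ⟨f', g', c', h1', h2', rfl⟩ := hy
    refine ⟨f * g' + g * f', g * g', c + c', ?_, ?_, ?_⟩
    · intro x; simpa using mul_pos (h1 x) (h1' x)
    · intro x
      simp only [eval_add, eval_mul]
      refine (abs_add_le _ _).trans ?_
      rw [abs_mul, abs_mul, abs_of_pos (h1 x), abs_of_pos (h1' x)]
      nlinarith [mul_le_mul_of_nonneg_right (h2 x) (h1' x).le,
        mul_le_mul_of_nonneg_right (h2' x) (h1 x).le]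
    · rw [div_add_div _ _ (hne _ h1) (hne _ h1')]; simp
  | neg x _ hx =>
    obtain ⟨f, g, c, h1, h2, rfl⟩ := hx
    exact ⟨-f, g, c, h1, by simpa using h2, by simp [neg_div]⟩
  | mul x y _ _ hx hy =>
    obtain ⟨f, g, c, h1, h2, rfl⟩ := hx
    obtain ⟨f', g', c', h1', h2', rfl⟩ := hy
    refine ⟨f * f', g * g', c * c', ?_, ?_, ?_⟩
    · intro x; simpa using mul_pos (h1 x) (h1' x)
    · intro x
      simp only [eval_mul, abs_mul]
      have := mul_le_mul (h2 x) (h2' x) (abs_nonneg _) ((abs_nonneg _).trans (h2 x))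
      linarith
    · rw [div_mul_div_comm]; simp

theorem dress_inv_mem (y : RatFunc ℝ) : (1 + y ^ 2)⁻¹ ∈ dressD :=
  Subring.subset_closure ⟨y, rfl⟩

theorem dress_const_mem (c : ℝ) : RatFunc.C c ∈ dressD := by
  have key : ∀ c : ℝ, 0 < c → c ≤ 1 → RatFunc.C c ∈ dressD := by
    intro c h0 h1
    have h := dress_inv_mem (RatFunc.C (Real.sqrt (1 / c - 1)))
    rw [← map_pow, Real.sq_sqrt (by rw [sub_nonneg, le_div_iff₀ h0]; linarith),
      ← map_one RatFunc.C, ← map_add, ← map_inv₀] at h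
    simpa using h
  -- c = n * (c / n) for n large
  rcases eq_or_ne c 0 with rfl | hc
  · simp
  have habs : RatFunc.C |c| ∈ dressD := by
    obtain ⟨n, hn⟩ := exists_nat_gt |c|
    have hc' : 0 < |c| := abs_pos.mpr hc
    have hn0 : (0 : ℝ) < n := hc'.trans hn
    have h := key (|c| / n) (by positivity) (by rw [div_le_one hn0]; exact hn.le)
    have h2 := dressD.mul_mem (natCast_mem dressD n) h
    rw [← map_natCast RatFunc.C, ← map_mul, mul_div_cancel₀ _ hn0.ne'] at h2
    exact h2
  rcases abs_choice c with h | h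
  · rwa [h] at habs
  · rw [h, map_neg] at habs
    simpa using dressD.neg_mem habs

theorem dress_quad_mem (α β c0 c1 c2 : ℝ) (hβ : β ≠ 0) :
    (RatFunc.C c2 * RatFunc.X ^ 2 + RatFunc.C c1 * RatFunc.X + RatFunc.C c0) /
      ((RatFunc.X - RatFunc.C α) ^ 2 + RatFunc.C β ^ 2) ∈ dressD := by
  have hb : RatFunc.C β ≠ 0 := by simpa using hβ
  have hx : ∀ γ : ℝ, RatFunc.X - RatFunc.C γ ≠ 0 := by
    intro γ h
    have h2 : algebraMap (Polynomial ℝ) (RatFunc ℝ) (Polynomial.X - Polynomial.C γ) = 0 := by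
      simpa using h
    exact RatFunc.algebraMap_ne_zero (Polynomial.X_sub_C_ne_zero γ) h2
  have hQ : (RatFunc.X - RatFunc.C α) ^ 2 + RatFunc.C β ^ 2 ≠ 0 := by
    intro h
    have h2 : algebraMap (Polynomial ℝ) (RatFunc ℝ)
        ((Polynomial.X - Polynomial.C α) ^ 2 + Polynomial.C β ^ 2) = 0 := by
      simpa using h
    have h3 : (Polynomial.X - Polynomial.C α) ^ 2 + Polynomial.C β ^ 2 = 0 := by
      by_contra h3
      exact RatFunc.algebraMap_ne_zero h3 h2
    have h4 := congrArg (Polynomial.eval α) h3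
    simp [hβ] at h4
  set x : RatFunc ℝ := RatFunc.X with hxdef
  set Q := (x - RatFunc.C α) ^ 2 + RatFunc.C β ^ 2 with hQdef
  have e0 : RatFunc.C β ^ 2 / Q ∈ dressD := by
    have h := dress_inv_mem ((x - RatFunc.C α) / RatFunc.C β)
    convert h using 1
    rw [div_pow, one_add_div (pow_ne_zero 2 hb), inv_div, hQdef, add_comm]
  have e1 : RatFunc.C (1 / 2) + RatFunc.C β * (x - RatFunc.C α) / Q ∈ dressD := by
    have hy : x - RatFunc.C α + RatFunc.C β ≠ 0 := by
      have := hx (α - β)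
      rw [map_sub] at this
      convert this using 1
      ring
    have h := dress_inv_mem ((x - RatFunc.C α - RatFunc.C β) / (x - RatFunc.C α + RatFunc.C β))
    convert h using 1
    have h2 : (RatFunc.C (1/2) : RatFunc ℝ) = 1 / 2 := by rw [map_div₀, map_one, map_ofNat]
    have h3 : (x - RatFunc.C α + RatFunc.C β) ^ 2 + (x - RatFunc.C α - RatFunc.C β) ^ 2 = 2 * Q := by
      rw [hQdef]; ring
    rw [div_pow, one_add_div (pow_ne_zero 2 hy), inv_div, h3, h2]
    have h22 : (2 : RatFunc ℝ) ≠ 0 := two_ne_zero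
    field_simp
    rw [hQdef]; ring
  set A := (c1 + 2 * α * c2) / β with hA
  set B := (c0 - c2 * α ^ 2 - c2 * β ^ 2 + A * β * α) / β ^ 2 with hB
  have h := dressD.add_mem (dressD.add_mem (dress_const_mem c2)
    (dressD.mul_mem (dress_const_mem A) (dressD.sub_mem e1 (dress_const_mem (1/2)))))
    (dressD.mul_mem (dress_const_mem B) e0)
  convert h using 1
  have hc1 : c1 = -2 * c2 * α + A * β := by rw [hA]; field_simp; ring
  have hc0 : c0 = c2 * α ^ 2 + c2 * β ^ 2 - A * β * α + B * β ^ 2 := by rw [hB]; field_simp; ring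
  clear_value A B
  subst hc1
  subst hc0
  simp only [map_add, map_sub, map_mul, map_pow, map_neg, map_ofNat]
  rw [add_sub_cancel_left]
  field_simp
  rw [hQdef]; ring

open Polynomial in
theorem dress_mem_of_degree (n : ℕ) : ∀ (f g : ℝ[X]), g.natDegree = n → (∀ x, g.eval x ≠ 0) →
    f.natDegree ≤ g.natDegree →
    algebraMap ℝ[X] (RatFunc ℝ) f / algebraMap ℝ[X] (RatFunc ℝ) g ∈ dressD := by
  induction n using Nat.strong_induction_on with
  | _ n ih =>
  intro f g hn hg hfg
  by_cases h0 : g.natDegree = 0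
  · have hf0 : f.natDegree = 0 := by omega
    rw [Polynomial.eq_C_of_natDegree_eq_zero h0, Polynomial.eq_C_of_natDegree_eq_zero hf0]
    simp only [RatFunc.algebraMap_C]
    rw [← map_div₀]
    exact dress_const_mem _
  · obtain ⟨z, hz⟩ := Complex.exists_root (f := g.map (algebraMap ℝ ℂ)) (by
      rw [Polynomial.degree_map]
      exact Polynomial.natDegree_pos_iff_degree_pos.mp (Nat.pos_of_ne_zero h0))
    have hz' : aeval z g = 0 := by
      simpa [IsRoot, eval_map_algebraMap] using hz
    have him : z.im ≠ 0 := by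
      intro him
      have : z = ((z.re : ℝ) : ℂ) := by apply Complex.ext <;> simp [him]
      rw [this] at hz'
      have h2 : (aeval (algebraMap ℝ ℂ z.re)) g = 0 := hz'
      rw [aeval_algebraMap_apply] at h2
      have h3 : aeval z.re g = 0 := by simpa using h2
      exact hg z.re (by simpa [coe_aeval_eq_eval] using h3)
    obtain ⟨g', hg'⟩ := Polynomial.quadratic_dvd_of_aeval_eq_zero_im_ne_zero g hz' him
    have hQeq : X ^ 2 - C (2 * z.re) * X + C (‖z‖ ^ 2) = (X - C z.re) ^ 2 + C z.im ^ 2 := by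
      rw [Complex.sq_norm, Complex.normSq_apply]
      simp only [map_add, map_mul, map_ofNat]
      ring
    rw [hQeq] at hg'
    have hQdeg : ((X - C z.re) ^ 2 + C z.im ^ 2 : ℝ[X]).natDegree = 2 := by
      rw [← C_pow, natDegree_add_C, natDegree_pow, natDegree_X_sub_C]
    have hQ0 : ((X - C z.re) ^ 2 + C z.im ^ 2 : ℝ[X]) ≠ 0 := by
      intro h; rw [h] at hQdeg; simp at hQdeg
    have hg0 : g' ≠ 0 := by
      rintro rfl
      exact hg 0 (by simp [hg'])
    have hdeg : g.natDegree = 2 + g'.natDegree := by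
      rw [hg', natDegree_mul hQ0 hg0, hQdeg]
    have hgr : ∀ x, g'.eval x ≠ 0 := by
      intro x hx
      exact hg x (by rw [hg', eval_mul, hx, mul_zero])
    have m1 := ih g'.natDegree (by omega) f.divX.divX g' rfl hgr (by
      rw [natDegree_divX_eq_natDegree_tsub_one, natDegree_divX_eq_natDegree_tsub_one]; omega)
    have m2 := ih g'.natDegree (by omega) 1 g' rfl hgr (by simp)
    have q1 := dress_quad_mem z.re z.im 0 0 1 him
    have q2 := dress_quad_mem z.re z.im (f.coeff 0) (f.divX.coeff 0) 0 him
    have h := dressD.add_mem (dressD.mul_mem q1 m1) (dressD.mul_mem q2 m2)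
    convert h using 1
    have hf : f = X ^ 2 * f.divX.divX + (C (f.divX.coeff 0) * X + C (f.coeff 0)) := by
      conv_lhs => rw [← X_mul_divX_add f, ← X_mul_divX_add f.divX]
      ring
    conv_lhs => rw [hf, hg']
    rw [div_mul_div_comm, div_mul_div_comm, ← add_div]
    simp

open Polynomial in
theorem dress_large_N {F H : ℝ[X]} (hdeg : F.natDegree ≤ H.natDegree) (hH0 : H ≠ 0)
    (hH : ∀ x, 0 ≤ H.eval x) (hF : ∀ x, H.eval x = 0 → 0 < F.eval x) :
    ∃ N : ℝ, (∀ x, 0 < (F + C N * H).eval x) ∧ (F + C N * H).natDegree = H.natDegree := by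
  have hpos : ∃ N : ℝ, ∀ M ≥ N, ∀ x, 0 < F.eval x + M * H.eval x := by
    have hO := Polynomial.isBigO_cobounded_of_degree_le (P := F) (Q := H) (by
      rw [degree_eq_natDegree hH0]
      exact degree_le_of_natDegree_le hdeg)
    obtain ⟨c, hc⟩ := hO.bound
    obtain ⟨K, hK, hKs⟩ := Filter.mem_cocompact.mp (Metric.cobounded_eq_cocompact (α := ℝ) ▸ hc)
    obtain ⟨n, hn⟩ := hK.elim_directed_cover
      (fun n : ℕ => {x : ℝ | 0 < F.eval x + n * H.eval x})
      (fun n => isOpen_lt continuous_const (by fun_prop))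
      (by
        intro x _
        rw [Set.mem_iUnion]
        rcases (hH x).eq_or_lt with h | h
        · exact ⟨0, by simpa using hF x h.symm⟩
        · obtain ⟨n, hn⟩ := exists_nat_gt (-F.eval x / H.eval x)
          rw [div_lt_iff₀ h] at hn
          exact ⟨n, by simp only [Set.mem_ofPred_eq]; linarith⟩)
      (by
        apply Monotone.directed_le (f := fun n : ℕ => {x : ℝ | 0 < F.eval x + n * H.eval x})
        intro a b hab x hx
        simp only [Set.mem_ofPred_eq] at hx ⊢
        have : (a : ℝ) ≤ b := by exact_mod_cast hab
        nlinarith [mul_le_mul_of_nonneg_right this (hH x)])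
    refine ⟨max n (c + 1), fun M hM x => ?_⟩
    have h1 : (n : ℝ) ≤ M := (le_max_left _ _).trans hM
    have h2 : c + 1 ≤ M := (le_max_right _ _).trans hM
    by_cases hx : x ∈ K
    · have := hn hx
      simp only [Set.mem_ofPred_eq] at this
      nlinarith [mul_le_mul_of_nonneg_right h1 (hH x)]
    · have := hKs hx
      simp only [Set.mem_ofPred_eq, Real.norm_eq_abs, abs_of_nonneg (hH x)] at this
      rcases (hH x).eq_or_lt with h | h
      · simpa [← h] using hF x h.symm
      · have h3 := (abs_le.mp this).1
        nlinarith [mul_le_mul_of_nonneg_right h2 (hH x)]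
  obtain ⟨N, hN⟩ := hpos
  have hl : H.coeff H.natDegree ≠ 0 := by simpa using hH0
  obtain ⟨M, hM, hMc⟩ : ∃ M ≥ N, F.coeff H.natDegree + M * H.coeff H.natDegree ≠ 0 := by
    by_contra! hcon
    have h1 := hcon N le_rfl
    have h2 := hcon (N + 1) (by linarith)
    apply hl
    linarith
  refine ⟨M, by simpa using hN M hM, le_antisymm ?_ ?_⟩
  · exact natDegree_add_le_of_degree_le hdeg (natDegree_C_mul_le _ _)
  · apply le_natDegree_of_ne_zero
    simpa using hMc

open Polynomial in
theorem dress_core {P Q G : ℝ[X]} (hP : P ≠ 0) (hG : ∀ x, 0 < G.eval x)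
    (hPG : P.natDegree ≤ G.natDegree) (hQP : Q.natDegree ≤ P.natDegree)
    (hs : ∀ x, P.eval x = 0 → 0 < Q.eval x) :
    ∃ a b c d u : dressD,
      (u * c : RatFunc ℝ) = algebraMap ℝ[X] (RatFunc ℝ) P / algebraMap ℝ[X] (RatFunc ℝ) G ∧
      (u * d : RatFunc ℝ) = algebraMap ℝ[X] (RatFunc ℝ) Q / algebraMap ℝ[X] (RatFunc ℝ) G ∧
      a + d = 1 ∧ a * d = b * c := by
  obtain ⟨m, hm⟩ : ∃ m, G.natDegree = P.natDegree + m := Nat.exists_eq_add_of_le hPG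
  set j := m / 2 with hj
  have hj2 : 2 * j ≤ m := by omega
  have hG0 : G ≠ 0 := by
    rintro rfl
    simpa using hG 0
  set K : ℝ[X] := X ^ 2 + C 1 with hK
  have hKdeg : K.natDegree = 2 := by rw [hK, natDegree_add_C, natDegree_X_pow]
  have hK0 : K ≠ 0 := by
    intro h; rw [h] at hKdeg; simp at hKdeg
  have hKpos : ∀ x, 0 < K.eval x := by
    intro x; simp [hK]; positivity
  clear_value K j
  have hKd : ∀ i, (K ^ i).natDegree = 2 * i := by
    intro i; rw [natDegree_pow, hKdeg, mul_comm]
  have hHdeg : (P ^ 2 * K ^ m).natDegree = 2 * G.natDegree := by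
    rw [natDegree_mul (pow_ne_zero _ hP) (pow_ne_zero _ hK0), hKd, natDegree_pow]; omega
  obtain ⟨N, hW, hWdeg⟩ := dress_large_N (F := Q * K ^ j * G) (H := P ^ 2 * K ^ m)
    (by
      rw [hHdeg]
      have h1 := natDegree_mul_le (p := Q * K ^ j) (q := G)
      have h2 := natDegree_mul_le (p := Q) (q := K ^ j)
      rw [hKd] at h2
      omega)
    (mul_ne_zero (pow_ne_zero _ hP) (pow_ne_zero _ hK0))
    (by
      intro x
      have := hKpos x
      simp only [eval_mul, eval_pow]
      positivity)
    (by
      intro x hx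
      simp only [eval_mul, eval_pow] at hx ⊢
      have h1 := hKpos x
      have h2 := hG x
      have h3 : P.eval x = 0 := by
        rcases mul_eq_zero.mp hx with h | h
        · exact pow_eq_zero_iff (two_ne_zero) |>.mp h
        · exact absurd h (pow_pos h1 m).ne'
      have h4 := hs x h3
      positivity)
  rw [hHdeg] at hWdeg
  set W := Q * K ^ j * G + C N * (P ^ 2 * K ^ m) with hWdef
  have hW0 : W ≠ 0 := by
    intro h
    have := hW 0
    simp [h] at this
  have hmem : ∀ f : ℝ[X], f.natDegree ≤ 2 * G.natDegree →
      algebraMap ℝ[X] (RatFunc ℝ) f / algebraMap ℝ[X] (RatFunc ℝ) W ∈ dressD := fun f hf =>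
    dress_mem_of_degree _ f W rfl (fun x => (hW x).ne') (by omega)
  have hgk : (G ^ 2 * K ^ j).natDegree = 2 * G.natDegree + 2 * j := by
    rw [natDegree_mul (pow_ne_zero _ hG0) (pow_ne_zero _ hK0), hKd, natDegree_pow]
  have hu : algebraMap ℝ[X] (RatFunc ℝ) W / algebraMap ℝ[X] (RatFunc ℝ) (G ^ 2 * K ^ j) ∈ dressD :=
    dress_mem_of_degree _ W _ rfl (fun x => by
      have h1 := hKpos x
      have h2 := hG x
      simp only [eval_mul, eval_pow]
      positivity) (by omega)
  have ha := hmem (C N * (P ^ 2 * K ^ m)) ((natDegree_C_mul_le _ _).trans hHdeg.le)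
  have hb := hmem (C N * (P * Q * K ^ m)) ((natDegree_C_mul_le _ _).trans (by
      have h1 := natDegree_mul_le (p := P * Q) (q := K ^ m)
      have h2 := natDegree_mul_le (p := P) (q := Q)
      rw [hKd] at h1
      omega))
  have hc := hmem (P * K ^ j * G) (by
      have h1 := natDegree_mul_le (p := P * K ^ j) (q := G)
      have h2 := natDegree_mul_le (p := P) (q := K ^ j)
      rw [hKd] at h2
      omega)
  have hd := hmem (Q * K ^ j * G) (by
      have h1 := natDegree_mul_le (p := Q * K ^ j) (q := G)
      have h2 := natDegree_mul_le (p := Q) (q := K ^ j)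
      rw [hKd] at h2
      omega)
  have hW' := RatFunc.algebraMap_ne_zero hW0
  have hG' := RatFunc.algebraMap_ne_zero hG0
  have hK' := RatFunc.algebraMap_ne_zero hK0
  refine ⟨⟨_, ha⟩, ⟨_, hb⟩, ⟨_, hc⟩, ⟨_, hd⟩, ⟨_, hu⟩, ?_, ?_, ?_, ?_⟩
  · simp only [map_mul, map_pow]
    clear_value W
    field_simp
  · simp only [map_mul, map_pow]
    clear_value W
    field_simp
  · apply Subtype.ext
    change _ / _ + _ / _ = (1 : RatFunc ℝ)
    rw [← add_div, ← map_add, div_eq_one_iff_eq hW', hWdef, add_comm]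
  · apply Subtype.ext
    change _ / _ * (_ / _) = (_ / _ * (_ / _) : RatFunc ℝ)
    rw [div_mul_div_comm, div_mul_div_comm, ← map_mul, ← map_mul]
    rw [← map_mul (algebraMap ℝ[X] (RatFunc ℝ)) (C N * (P * Q * K ^ m)) (P * K ^ j * G)]
    congr 2
    ring

section Mat
variable {R : Type*} [CommRing R]

theorem dress_left_mem (x : R) : !![x, 0; 0, 0] ∈
    Submonoid.closure {E : Matrix (Fin 2) (Fin 2) R | E * E = E} := by
  have h : !![x, 0; 0, 0] = !![1, x - 1; 0, 0] * !![1, 0; 1, 0] := by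
    ext i j; fin_cases i <;> fin_cases j <;> simp [Matrix.mul_apply]
  rw [h]
  apply Submonoid.mul_mem <;> apply Submonoid.subset_closure <;>
    · simp only [Set.mem_ofPred_eq]
      ext i j; fin_cases i <;> fin_cases j <;> simp [Matrix.mul_apply]

theorem dress_right_mem (x : R) : !![0, x; 0, 0] ∈
    Submonoid.closure {E : Matrix (Fin 2) (Fin 2) R | E * E = E} := by
  have h : !![0, x; 0, 0] = !![1, x; 0, 0] * !![0, 0; 0, 1] := by
    ext i j; fin_cases i <;> fin_cases j <;> simp [Matrix.mul_apply]
  rw [h]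
  apply Submonoid.mul_mem <;> apply Submonoid.subset_closure <;>
    · simp only [Set.mem_ofPred_eq]
      ext i j; fin_cases i <;> fin_cases j <;> simp [Matrix.mul_apply]

theorem dress_mat_one {p q a b c d u : R} (hp : u * c = p) (hq : u * d = q) (h1 : a + d = 1)
    (h2 : a * d = b * c) : !![p, q; 0, 0] ∈
    Submonoid.closure {E : Matrix (Fin 2) (Fin 2) R | E * E = E} := by
  have h : !![p, q; 0, 0] = !![0, u; 0, 0] * !![a, b; c, d] := by
    ext i j; fin_cases i <;> fin_cases j <;> simp [Matrix.mul_apply, hp, hq]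
  rw [h]
  refine Submonoid.mul_mem _ (dress_right_mem u) (Submonoid.subset_closure ?_)
  simp only [Set.mem_ofPred_eq]
  ext i j; fin_cases i <;> fin_cases j <;> simp [Matrix.mul_apply]
  · linear_combination a * h1 - h2
  · linear_combination b * h1
  · linear_combination c * h1
  · linear_combination d * h1 - h2

theorem dress_mat_two {p q a b c d u : R} (hq : u * c = q) (hp : u * d = p) (h1 : a + d = 1)
    (h2 : a * d = b * c) : !![p, q; 0, 0] ∈
    Submonoid.closure {E : Matrix (Fin 2) (Fin 2) R | E * E = E} := by
  have h : !![p, q; 0, 0] = !![u, 0; 0, 0] * !![d, c; b, a] := by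
    ext i j; fin_cases i <;> fin_cases j <;> simp [Matrix.mul_apply, hp, hq]
  rw [h]
  refine Submonoid.mul_mem _ (dress_left_mem u) (Submonoid.subset_closure ?_)
  simp only [Set.mem_ofPred_eq]
  ext i j; fin_cases i <;> fin_cases j <;> simp [Matrix.mul_apply]
  · linear_combination d * h1 - h2
  · linear_combination c * h1
  · linear_combination b * h1
  · linear_combination a * h1 - h2

end Mat

open Polynomial in
theorem dress_eval {r : RatFunc ℝ} {F G : ℝ[X]} (hG : ∀ x, 0 < G.eval x)
    (hr : r = algebraMap ℝ[X] (RatFunc ℝ) F / algebraMap ℝ[X] (RatFunc ℝ) G) (x : ℝ) :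
    r.eval (RingHom.id ℝ) x = F.eval x / G.eval x := by
  have hG0 : G ≠ 0 := by
    rintro rfl
    simpa using hG 0
  have h1 : r.num * G = F * r.denom := (RatFunc.num_mul_eq_mul_denom_iff hG0).mpr hr
  have h2 : r.denom ∣ G := (RatFunc.denom_dvd hG0).mpr ⟨F, hr⟩
  have h3 : r.denom.eval x ≠ 0 := by
    intro h
    obtain ⟨k, hk⟩ := h2
    have := hG x
    rw [hk, eval_mul, h, zero_mul] at this
    exact lt_irrefl _ this
  have h4 := congrArg (Polynomial.eval x) h1
  simp only [eval_mul] at h4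
  rw [RatFunc.eval]
  change r.num.eval x / r.denom.eval x = _
  rw [div_eq_div_iff h3 (hG x).ne', h4]

theorem dress_main {p q : RatFunc ℝ} (hp : p ∈ dressD) (hq : q ∈ dressD) (hp0 : p ≠ 0)
    (hdeg : q.intDegree ≤ p.intDegree)
    (hs : (∀ u : ℝ, p.eval (RingHom.id ℝ) u = 0 → 0 < q.eval (RingHom.id ℝ) u) ∨
             (∀ u : ℝ, p.eval (RingHom.id ℝ) u = 0 → q.eval (RingHom.id ℝ) u < 0)) :
    ∃ a b c d u : dressD, u * c = ⟨p, hp⟩ ∧ u * d = ⟨q, hq⟩ ∧ a + d = 1 ∧ a * d = b * c := by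
  obtain ⟨f, g, c, hg, hfg, hpe⟩ := dress_exists_rep hp
  obtain ⟨f', g', c', hg', hfg', hqe⟩ := dress_exists_rep hq
  have hne : ∀ g : Polynomial ℝ, (∀ x, 0 < g.eval x) → g ≠ 0 := by
    rintro _ hg rfl
    simpa using hg 0
  have hg0 := hne _ hg
  have hg0' := hne _ hg'
  have hA := RatFunc.algebraMap_ne_zero hg0
  have hA' := RatFunc.algebraMap_ne_zero hg0'
  have hG : ∀ x, 0 < (g * g').eval x := fun x => by
    rw [Polynomial.eval_mul]; exact mul_pos (hg x) (hg' x)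
  have hpe' : p = algebraMap (Polynomial ℝ) (RatFunc ℝ) (f * g') /
      algebraMap (Polynomial ℝ) (RatFunc ℝ) (g * g') := by
    rw [hpe, map_mul, map_mul, mul_div_mul_right _ _ hA']
  have hqe' : q = algebraMap (Polynomial ℝ) (RatFunc ℝ) (f' * g) /
      algebraMap (Polynomial ℝ) (RatFunc ℝ) (g * g') := by
    rw [hqe, map_mul, map_mul, mul_comm, mul_div_mul_left _ _ hA]
  have hf0 : f ≠ 0 := by
    rintro rfl
    simp at hpe
    exact hp0 hpe
  have hP0 : f * g' ≠ 0 := mul_ne_zero hf0 hg0'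
  have hPG : (f * g').natDegree ≤ (g * g').natDegree := by
    rw [Polynomial.natDegree_mul hf0 hg0', Polynomial.natDegree_mul hg0 hg0']
    have := dress_of_bdd_degree hg hfg
    omega
  have hint : ∀ F : Polynomial ℝ, F ≠ 0 → (algebraMap (Polynomial ℝ) (RatFunc ℝ) F /
      algebraMap (Polynomial ℝ) (RatFunc ℝ) (g * g')).intDegree =
        F.natDegree - (g * g').natDegree := by
    intro F hF
    rw [RatFunc.intDegree_div (RatFunc.algebraMap_ne_zero hF)
      (RatFunc.algebraMap_ne_zero (mul_ne_zero hg0 hg0')), RatFunc.intDegree_polynomial,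
      RatFunc.intDegree_polynomial]
  have hQP : (f' * g).natDegree ≤ (f * g').natDegree := by
    by_cases hf0' : f' = 0
    · simp [hf0']
    · rw [hpe', hqe', hint _ hP0, hint _ (mul_ne_zero hf0' hg0)] at hdeg
      omega
  have ep : ∀ x, (f * g').eval x = 0 → p.eval (RingHom.id ℝ) x = 0 := by
    intro x hx
    rw [dress_eval hG hpe' x, hx, zero_div]
  have eq := dress_eval hG hqe'
  rcases hs with hs | hs
  · obtain ⟨a, b, c, d, u, h1, h2, h3, h4⟩ := dress_core hP0 hG hPG hQP (by
      intro x hx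
      have h := hs x (ep x hx)
      rw [eq] at h
      exact (div_pos_iff_of_pos_right (hG x)).mp h)
    exact ⟨a, b, c, d, u, Subtype.ext (h1.trans hpe'.symm), Subtype.ext (h2.trans hqe'.symm),
      h3, h4⟩
  · obtain ⟨a, b, c, d, u, h1, h2, h3, h4⟩ := dress_core (Q := -(f' * g)) hP0 hG hPG
      (by rwa [Polynomial.natDegree_neg]) (by
      intro x hx
      have h := hs x (ep x hx)
      rw [eq] at h
      rw [Polynomial.eval_neg]
      have := (div_neg_iff.mp h)
      have := hG x
      rcases div_neg_iff.mp h with h | h <;> linarith [h.1, h.2])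
    refine ⟨a, -b, -c, d, -u, Subtype.ext ?_, Subtype.ext ?_, h3, by rw [h4]; ring⟩
    · rw [neg_mul_neg]; exact h1.trans hpe'.symm
    · rw [map_neg, neg_div, ← hqe'] at h2
      rw [neg_mul]
      change -(u * d : RatFunc ℝ) = q
      rw [h2, neg_neg]

/-- Let `D` be the minimal Dress ring of `ℝ(X)` and `p, q ∈ D`.  If
either `deg p ≥ deg q` and `q` has constant sign on the real roots of `p`, or
`deg q ≥ deg p` and `p` has constant sign on the real roots of `q`, then the matrix
`!![p, q; 0, 0]` over `D` is a product of idempotent `2×2` matrices over `D`. -/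
theorem minimalDressRing_matrix_prod_idempotents (p q : RatFunc ℝ)
    (hp : p ∈ Subring.closure {s : RatFunc ℝ | ∃ x : RatFunc ℝ, s = (1 + x ^ 2)⁻¹})
    (hq : q ∈ Subring.closure {s : RatFunc ℝ | ∃ x : RatFunc ℝ, s = (1 + x ^ 2)⁻¹})
    (h : (q.intDegree ≤ p.intDegree ∧
            ((∀ u : ℝ, p.eval (RingHom.id ℝ) u = 0 → 0 < q.eval (RingHom.id ℝ) u) ∨
             (∀ u : ℝ, p.eval (RingHom.id ℝ) u = 0 → q.eval (RingHom.id ℝ) u < 0))) ∨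
         (p.intDegree ≤ q.intDegree ∧
            ((∀ z : ℝ, q.eval (RingHom.id ℝ) z = 0 → 0 < p.eval (RingHom.id ℝ) z) ∨
             (∀ z : ℝ, q.eval (RingHom.id ℝ) z = 0 → p.eval (RingHom.id ℝ) z < 0)))) :
    !![(⟨p, hp⟩ : ↥(Subring.closure
          {s : RatFunc ℝ | ∃ x : RatFunc ℝ, s = (1 + x ^ 2)⁻¹})), ⟨q, hq⟩; 0, 0] ∈
      Submonoid.closure {E : Matrix (Fin 2) (Fin 2)
        ↥(Subring.closure {s : RatFunc ℝ | ∃ x : RatFunc ℝ, s = (1 + x ^ 2)⁻¹}) |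
          E * E = E} := by
  rcases h with ⟨hd, hs⟩ | ⟨hd, hs⟩
  · by_cases hp0 : p = 0
    · subst hp0
      exact dress_right_mem _
    · obtain ⟨a, b, c, d, u, h1, h2, h3, h4⟩ := dress_main hp hq hp0 hd hs
      exact dress_mat_one h1 h2 h3 h4
  · by_cases hq0 : q = 0
    · subst hq0
      exact dress_left_mem _
    · obtain ⟨a, b, c, d, u, h1, h2, h3, h4⟩ := dress_main hq hp hq0 hd hs
      exact dress_mat_two h1 h2 h3 h4
end

section
/- Let D be the minimal Dress ring of ℝ(X). Let x, y be real polynomials of degree at most 1 and γ a real polynomial without real roots such that p = x/γ and q = y/γ both lie in D. Then the 2×2 matrix over D with first row (p, q) and second row (0, 0) is a product of idempotent 2×2 matrices over D. Moreover, if instead x, y are real polynomials with deg x = deg y = 2 whose gcd has degree at least 1, and γ is a real polynomial without real roots with p = x/γ, q = y/γ ∈ D, then the same conclusion holds: the matrix with rows (p, q) and (0, 0) is a product of idempotent matrices over D. -/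
/-- The minimal Dress ring of `ℝ(X)`. -/
noncomputable def minimalDressRing : Subring (RatFunc ℝ) :=
  Subring.closure {s : RatFunc ℝ | ∃ x : RatFunc ℝ, s = (1 + x ^ 2)⁻¹}

open Polynomial

namespace DressAux

section general
variable {R : Type*} [CommRing R]

abbrev IC (R : Type*) [CommRing R] : Submonoid (Matrix (Fin 2) (Fin 2) R) :=
  Submonoid.closure {E : Matrix (Fin 2) (Fin 2) R | E * E = E}

lemma idem_mem {A B C D : R} (h1 : A * A + B * C = A) (h2 : A * B + B * D = B)
    (h3 : C * A + D * C = C) (h4 : C * B + D * D = D) : !![A, B; C, D] ∈ IC R := by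
  apply Submonoid.subset_closure
  show _ * _ = _
  rw [Matrix.mul_fin_two, h1, h2, h3, h4]

lemma row_left (r b : R) : !![r, r * b; 0, 0] ∈ IC R := by
  have h : !![r, r * b; 0, 0] =
      !![1, 1; 0, 0] * !![0, 0; r, 1] * !![1, 0; 0, 0] * !![1, b; 0, 0] := by
    simp
  rw [h]
  refine mul_mem (mul_mem (mul_mem ?_ ?_) ?_) ?_ <;> apply idem_mem <;> ring

lemma row_right (r b : R) : !![r * b, r; 0, 0] ∈ IC R := by
  have h : !![r * b, r; 0, 0] =
      !![1, r; 0, 0] * !![0, 0; 0, 1] * !![0, 0; b, 1] := by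
    simp
  rw [h]
  refine mul_mem (mul_mem ?_ ?_) ?_ <;> apply idem_mem <;> ring

lemma row_main (k v w A B C : R) (hv : !![v, w; 0, 0] ∈ IC R) (h1 : A + C = 1)
    (h2 : A * C = B * B) :
    !![k * (v * A + w * B), k * (v * B + w * C); 0, 0] ∈ IC R := by
  have h : !![k * (v * A + w * B), k * (v * B + w * C); 0, 0] =
      !![k, k * 0; 0, 0] * !![v, w; 0, 0] * !![A, B; B, C] := by
    simp
    constructor <;> ring
  rw [h]
  refine mul_mem (mul_mem (row_left _ _) hv) ?_
  have hC : C = 1 - A := by rw [← h1]; ring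
  subst hC
  apply idem_mem
  · rw [← h2]; ring
  · ring
  · ring
  · rw [← h2]; ring

end general

local notation "φ" => algebraMap (Polynomial ℝ) (RatFunc ℝ)

lemma phi_ne {a : ℝ[X]} (h : a ≠ 0) : φ a ≠ 0 := by
  simpa using h

lemma inv_mem (t : RatFunc ℝ) : (1 + t ^ 2)⁻¹ ∈ minimalDressRing :=
  Subring.subset_closure ⟨t, rfl⟩

lemma degree_sum_sq (a b : ℝ[X]) : (b ^ 2).degree ≤ (a ^ 2 + b ^ 2).degree := by
  by_cases ha : a = 0
  · simp [ha]
  by_cases hb : b = 0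
  · simp [hb]
  have h := Polynomial.degree_add_eq_of_leadingCoeff_add_ne_zero (p := a ^ 2) (q := b ^ 2) (by
    have := pow_pos (abs_pos.2 (leadingCoeff_ne_zero.2 ha)) 2
    have := pow_pos (abs_pos.2 (leadingCoeff_ne_zero.2 hb)) 2
    rw [sq_abs] at *
    rw [leadingCoeff_pow, leadingCoeff_pow]
    positivity)
  rw [h]
  exact le_max_right _ _

lemma sum_sq_ne {a b : ℝ[X]} (hb : b ≠ 0) : a ^ 2 + b ^ 2 ≠ 0 := by
  intro h
  have := degree_sum_sq a b
  rw [h, degree_zero, le_bot_iff, degree_eq_bot] at this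
  exact hb (pow_eq_zero_iff (two_ne_zero) |>.1 this)

/-- elements of the Dress ring are bounded at infinity -/
lemma bounded {r : RatFunc ℝ} (hr : r ∈ minimalDressRing) :
    ∃ a b : ℝ[X], b ≠ 0 ∧ a.degree ≤ b.degree ∧ r = φ a / φ b := by
  induction hr using Subring.closure_induction with
  | mem x hx =>
    obtain ⟨t, rfl⟩ := hx
    refine ⟨t.denom ^ 2, t.num ^ 2 + t.denom ^ 2, sum_sq_ne t.denom_ne_zero,
      degree_sum_sq _ _, ?_⟩
    have hd := phi_ne t.denom_ne_zero
    have hs := phi_ne (sum_sq_ne (a := t.num) t.denom_ne_zero)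
    conv_lhs => rw [← RatFunc.num_div_denom t]
    rw [map_add, map_pow, map_pow] at *
    have : 1 + (φ t.num / φ t.denom) ^ 2 = (φ t.num ^ 2 + φ t.denom ^ 2) / φ t.denom ^ 2 := by
      field_simp
      ring
    rw [this, inv_div]
  | zero => exact ⟨0, 1, one_ne_zero, by simp, by simp⟩
  | one => exact ⟨1, 1, one_ne_zero, le_rfl, by simp⟩
  | add x y _ _ hx hy =>
    obtain ⟨a, b, hb, hab, rfl⟩ := hx
    obtain ⟨c, d, hd, hcd, rfl⟩ := hy
    refine ⟨a * d + b * c, b * d, mul_ne_zero hb hd, ?_, ?_⟩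
    · refine (degree_add_le _ _).trans (max_le ?_ ?_) <;> rw [degree_mul, degree_mul] <;> gcongr
    · rw [div_add_div _ _ (phi_ne hb) (phi_ne hd)]; simp
  | neg x _ hx =>
    obtain ⟨a, b, hb, hab, rfl⟩ := hx
    exact ⟨-a, b, hb, by simpa using hab, by simp [neg_div]⟩
  | mul x y _ _ hx hy =>
    obtain ⟨a, b, hb, hab, rfl⟩ := hx
    obtain ⟨c, d, hd, hcd, rfl⟩ := hy
    refine ⟨a * c, b * d, mul_ne_zero hb hd, ?_, ?_⟩
    · rw [degree_mul, degree_mul]; gcongr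
    · rw [div_mul_div_comm]; simp

lemma degree_le_of_mem {x γ : ℝ[X]} (hγ : γ ≠ 0) (h : φ x / φ γ ∈ minimalDressRing) :
    x.natDegree ≤ γ.natDegree := by
  obtain ⟨a, b, hb, hab, h⟩ := bounded h
  rw [div_eq_div_iff (phi_ne hγ) (phi_ne hb), ← map_mul, ← map_mul] at h
  have h := RatFunc.algebraMap_injective ℝ h
  by_cases hx : x = 0
  · simp [hx]
  have ha : a ≠ 0 := by
    rintro rfl
    simp [hx, hb] at h
  have h2 := congrArg natDegree h
  rw [natDegree_mul hx hb, natDegree_mul ha hγ] at h2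
  have := natDegree_le_natDegree hab
  omega

lemma const_mem (c : ℝ) : φ (C c) ∈ minimalDressRing := by
  have key : ∀ d : ℝ, φ (C ((1 + d ^ 2)⁻¹)) ∈ minimalDressRing := by
    intro d
    convert inv_mem (φ (C d)) using 1
    have hd : (1 + d ^ 2) ≠ 0 := by positivity
    apply eq_inv_of_mul_eq_one_left
    rw [← map_one φ, ← map_pow, ← map_add, ← map_mul, ← C_1, ← C_pow, ← C_add, ← C_mul,
      inv_mul_cancel₀ hd]
  have pos1 : ∀ e : ℝ, 0 < e → e ≤ 1 → φ (C e) ∈ minimalDressRing := by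
    intro e he he1
    have := key (Real.sqrt (e⁻¹ - 1))
    rw [Real.sq_sqrt (by have := (one_le_inv₀ he).2 he1; linarith)] at this
    simpa using this
  have pos : ∀ e : ℝ, 0 < e → φ (C e) ∈ minimalDressRing := by
    intro e he
    obtain ⟨n, hn⟩ := exists_nat_gt e
    have hn0 : (0 : ℝ) < n := he.trans hn
    have h1 := pos1 (e / n) (by positivity) (by rw [div_le_one hn0]; exact hn.le)
    have h2 := mul_mem (natCast_mem minimalDressRing n) h1
    convert h2 using 1
    rw [← map_natCast φ, ← map_mul, ← C_eq_natCast, ← C_mul]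
    congr 2
    field_simp
  rcases lt_trichotomy c 0 with h | h | h
  · have := neg_mem (pos (-c) (by linarith))
    simpa using this
  · simp [h, zero_mem]
  · exact pos c h

lemma t_mem (t : RatFunc ℝ) (ht : 1 + t ^ 2 ≠ 0) : t / (1 + t ^ 2) ∈ minimalDressRing := by
  have half : (2 : RatFunc ℝ)⁻¹ ∈ minimalDressRing := by
    have := inv_mem 1
    norm_num at this
    rwa [one_div] at this
  have h2 : (2 : RatFunc ℝ) ≠ 0 := two_ne_zero
  by_cases h1 : t = 1
  · subst h1
    convert half using 1
    norm_num
  have h1' : 1 - t ≠ 0 := sub_ne_zero.2 (Ne.symm h1)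
  convert sub_mem half (inv_mem ((1 + t) / (1 - t))) using 1
  have : 1 + ((1 + t) / (1 - t)) ^ 2 = 2 * (1 + t ^ 2) / (1 - t) ^ 2 := by
    field_simp
    ring
  rw [this, inv_div]
  field_simp
  ring

lemma quad_mem (a b : ℝ) (hb : b ≠ 0) (r : ℝ[X]) (hr : r.natDegree ≤ 1) :
    φ r / φ ((X - C a) ^ 2 + C b ^ 2) ∈ minimalDressRing := by
  have hb' : φ (C b) ≠ 0 := phi_ne (C_ne_zero.2 hb)
  set t : RatFunc ℝ := φ (X - C a) / φ (C b) with ht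
  have hN : φ ((X - C a) ^ 2 + C b ^ 2) ≠ 0 := phi_ne (sum_sq_ne (C_ne_zero.2 hb))
  have h1 : 1 + t ^ 2 = φ ((X - C a) ^ 2 + C b ^ 2) / φ (C b) ^ 2 := by
    rw [ht, map_add, map_pow, map_pow]
    field_simp
    ring
  have h1' : 1 + t ^ 2 ≠ 0 := by
    rw [h1]; exact div_ne_zero hN (pow_ne_zero _ hb')
  obtain ⟨c, d, rfl⟩ := exists_eq_X_add_C_of_natDegree_le_one hr
  have m := add_mem (mul_mem (const_mem (c * b⁻¹)) (t_mem t h1'))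
    (mul_mem (const_mem ((c * a + d) * (b ^ 2)⁻¹)) (inv_mem t))
  convert m using 1
  rw [h1, inv_div, ht]
  have e1 : φ (C (c * b⁻¹)) = φ (C c) / φ (C b) := by
    rw [eq_div_iff hb', ← map_mul, ← C_mul]
    congr 2
    field_simp
  have e2 : φ (C ((c * a + d) * (b ^ 2)⁻¹)) = φ (C c * C a + C d) / φ (C b) ^ 2 := by
    rw [eq_div_iff (pow_ne_zero _ hb'), ← map_pow, ← map_mul, ← C_pow, ← C_mul, ← C_mul, ← C_add]
    congr 2
    field_simp
  rw [e1, e2]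
  field_simp
  rw [← map_mul, ← map_add]
  congr 1
  ring

lemma irred_form {q : ℝ[X]} (hq : Irreducible q) (hr : ∀ t : ℝ, q.eval t ≠ 0) :
    q.natDegree = 2 ∧ ∃ k a b : ℝ, k ≠ 0 ∧ b ≠ 0 ∧ q = C k * ((X - C a) ^ 2 + C b ^ 2) := by
  have h2 : q.natDegree ≤ 2 := hq.natDegree_le_two
  have h0 : q.natDegree ≠ 0 := hq.natDegree_pos.ne'
  have h1 : q.natDegree ≠ 1 := by
    intro h
    obtain ⟨t, ht⟩ := Polynomial.exists_root_of_degree_eq_one (p := q)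
      (by rw [degree_eq_natDegree hq.ne_zero, h]; rfl)
    exact hr t ht
  have h : q.natDegree = 2 := by omega
  refine ⟨h, ?_⟩
  have hk : q.coeff 2 ≠ 0 := by
    rw [← h]; exact leadingCoeff_ne_zero.2 hq.ne_zero
  set k := q.coeff 2 with hkd
  set l := q.coeff 1 with hl
  set m := q.coeff 0 with hm
  have hq2 : q = C k * X ^ 2 + C l * X + C m := by
    rw [hkd, hl, hm]
    exact eq_quadratic_of_degree_le_two (natDegree_le_iff_degree_le.1 h2)
  have hpos : 0 < m / k - (l / (2 * k)) ^ 2 := by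
    by_contra hneg
    push Not at hneg
    apply hr (-(l / (2 * k)) + Real.sqrt (-(m / k - (l / (2 * k)) ^ 2)))
    have hs := Real.sq_sqrt (show 0 ≤ -(m / k - (l / (2 * k)) ^ 2) by linarith)
    set s := Real.sqrt (-(m / k - (l / (2 * k)) ^ 2))
    rw [hq2]
    simp only [eval_add, eval_mul, eval_C, eval_pow, eval_X]
    have : k * (-(l / (2 * k)) + s) ^ 2 + l * (-(l / (2 * k)) + s) + m
      = k * (s ^ 2 + (m / k - (l / (2 * k)) ^ 2)) := by
      field_simp
      ring
    rw [this, hs]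
    ring
  refine ⟨k, -(l / (2 * k)), Real.sqrt (m / k - (l / (2 * k)) ^ 2), hk,
    (Real.sqrt_pos.2 hpos).ne', ?_⟩
  rw [← C_pow, Real.sq_sqrt hpos.le]
  conv_lhs => rw [hq2]
  have e1 : l = k * (2 * (l / (2 * k))) := by field_simp
  have e2 : m = k * (m / k) := by field_simp
  conv_lhs => rw [e2]
  conv_lhs => enter [1, 2, 1]; rw [e1]
  simp only [C_mul, C_sub, C_neg, C_pow]
  have : (C 2 : ℝ[X]) = 2 := rfl
  rw [this]
  ring

lemma frac_mem : ∀ (n : ℕ) (γ : ℝ[X]), γ.natDegree = n → (∀ t : ℝ, γ.eval t ≠ 0) →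
    ∀ f : ℝ[X], f.natDegree ≤ γ.natDegree → φ f / φ γ ∈ minimalDressRing := by
  intro n
  induction n using Nat.strong_induction_on with
  | _ n ih =>
  intro γ hn hγ f hf
  have hγ0 : γ ≠ 0 := by rintro rfl; exact hγ 0 (by simp)
  by_cases hu : IsUnit γ
  · have h0 := natDegree_eq_zero_of_isUnit hu
    rw [eq_C_of_natDegree_eq_zero h0, eq_C_of_natDegree_eq_zero (p := f) (by omega)]
    have hc : γ.coeff 0 ≠ 0 := by
      intro h
      rw [eq_C_of_natDegree_eq_zero h0, h] at hγ0
      simp at hγ0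
    convert const_mem (f.coeff 0 / γ.coeff 0) using 1
    rw [div_eq_iff (phi_ne (C_ne_zero.2 hc)), ← map_mul, ← C_mul, div_mul_cancel₀ _ hc]
  obtain ⟨q, hq, g, rfl⟩ := WfDvdMonoid.exists_irreducible_factor hu hγ0
  have hqe : ∀ t : ℝ, q.eval t ≠ 0 := fun t h => hγ t (by simp [h])
  have hge : ∀ t : ℝ, g.eval t ≠ 0 := fun t h => hγ t (by simp [h])
  have hg0 : g ≠ 0 := right_ne_zero_of_mul hγ0
  obtain ⟨hd, k, a, b, hk, hb, hqf⟩ := irred_form hq hqe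
  rw [natDegree_mul hq.ne_zero hg0] at hn hf
  have hdiv := EuclideanDomain.div_add_mod f q
  have hr : (f % q).natDegree ≤ 1 := by
    have := natDegree_mod_lt f (q := q) (by omega)
    omega
  have hf1 : (f / q).natDegree ≤ g.natDegree := by
    by_cases h0 : f / q = 0
    · simp [h0]
    have h3 : q * (f / q) = f - f % q := by rw [eq_sub_iff_add_eq, hdiv]
    have h4 := natDegree_sub_le f (f % q)
    rw [← h3, natDegree_mul hq.ne_zero h0] at h4
    have h5 := max_le hf (show (f % q).natDegree ≤ q.natDegree + g.natDegree by omega)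
    omega
  have m1 := ih g.natDegree (by omega) g rfl hge _ hf1
  have m2 := ih g.natDegree (by omega) g rfl hge 1 (by simp)
  have m3 := mul_mem (const_mem k⁻¹) (quad_mem a b hb _ hr)
  have m := add_mem m1 (mul_mem m2 m3)
  convert m using 1
  have e1 : φ (C k⁻¹) = 1 / φ (C k) := by
    rw [eq_div_iff (phi_ne (C_ne_zero.2 hk)), ← map_mul, ← C_mul, inv_mul_cancel₀ hk]
    simp
  have n1 := phi_ne (C_ne_zero.2 hk)
  have n2 := phi_ne hg0
  have n3 : φ ((X - C a) ^ 2 + C b ^ 2) ≠ 0 := phi_ne (sum_sq_ne (C_ne_zero.2 hb))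
  have n4 : φ q = φ (C k) * φ ((X - C a) ^ 2 + C b ^ 2) := by rw [← map_mul, ← hqf]
  have n5 := phi_ne hq.ne_zero
  have e2 : φ f = φ q * φ (f / q) + φ (f % q) := by rw [← map_mul, ← map_add, hdiv]
  have e3 : φ (C k⁻¹) * (φ (f % q) / φ ((X - C a) ^ 2 + C b ^ 2)) = φ (f % q) / φ q := by
    rw [e1, n4]; field_simp
  rw [e3, e2, map_mul, map_one]
  field_simp

lemma smul_left (x y γ : ℝ[X]) (c : ℝ) (h : y = C c * x)
    (hp : φ x / φ γ ∈ minimalDressRing) (hq : φ y / φ γ ∈ minimalDressRing) :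
    !![(⟨_, hp⟩ : ↥minimalDressRing), ⟨_, hq⟩; 0, 0] ∈ IC ↥minimalDressRing := by
  have : (⟨_, hq⟩ : ↥minimalDressRing) = ⟨_, hp⟩ * ⟨_, const_mem c⟩ := by
    apply Subtype.ext
    simp only [h, map_mul, Subring.coe_mul]
    ring
  rw [this]
  exact row_left _ _

lemma smul_right (x y γ : ℝ[X]) (c : ℝ) (h : x = C c * y)
    (hp : φ x / φ γ ∈ minimalDressRing) (hq : φ y / φ γ ∈ minimalDressRing) :
    !![(⟨_, hp⟩ : ↥minimalDressRing), ⟨_, hq⟩; 0, 0] ∈ IC ↥minimalDressRing := by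
  have : (⟨_, hp⟩ : ↥minimalDressRing) = ⟨_, hq⟩ * ⟨_, const_mem c⟩ := by
    apply Subtype.ext
    simp only [h, map_mul, Subring.coe_mul]
    ring
  rw [this]
  exact row_right _ _

lemma const_row (v w : ℝ) :
    !![(⟨_, const_mem v⟩ : ↥minimalDressRing), ⟨_, const_mem w⟩; 0, 0] ∈ IC ↥minimalDressRing := by
  by_cases hv : v = 0
  · have : (⟨_, const_mem v⟩ : ↥minimalDressRing) = ⟨_, const_mem w⟩ * 0 := by
      apply Subtype.ext
      simp [hv]
    rw [this]
    exact row_right _ _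
  · have : (⟨_, const_mem w⟩ : ↥minimalDressRing) =
        ⟨_, const_mem v⟩ * ⟨_, const_mem (w / v)⟩ := by
      apply Subtype.ext
      simp only [Subring.coe_mul]
      rw [← map_mul, ← C_mul, mul_div_cancel₀ _ hv]
    rw [this]
    exact row_left _ _

lemma main (l x y γ : ℝ[X]) (hγ : ∀ t : ℝ, γ.eval t ≠ 0) (hl : l.natDegree ≤ 1)
    (hx : x.natDegree ≤ 1) (hy : y.natDegree ≤ 1)
    (hp : φ (l * x) / φ γ ∈ minimalDressRing) (hq : φ (l * y) / φ γ ∈ minimalDressRing) :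
    !![(⟨_, hp⟩ : ↥minimalDressRing), ⟨_, hq⟩; 0, 0] ∈ IC ↥minimalDressRing := by
  have hγ0 : γ ≠ 0 := by rintro rfl; exact hγ 0 (by simp)
  by_cases hl0 : l = 0
  · exact smul_left _ _ _ 0 (by simp [hl0]) hp hq
  have hd1 := degree_le_of_mem hγ0 hp
  have hd2 := degree_le_of_mem hγ0 hq
  obtain ⟨a, b, rfl⟩ := exists_eq_X_add_C_of_natDegree_le_one hx
  obtain ⟨c, d, rfl⟩ := exists_eq_X_add_C_of_natDegree_le_one hy
  by_cases hdet : a * d - b * c = 0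
  · by_cases ha : a = 0
    · by_cases hb : b = 0
      · exact smul_right _ _ _ 0 (by simp [ha, hb]) hp hq
      · have hc : c = 0 := by
          rw [ha] at hdet
          have : b * c = 0 := by linarith
          exact (mul_eq_zero.1 this).resolve_left hb
        refine smul_left _ _ _ (d / b) ?_ hp hq
        have : C d = C (d / b) * C b := by rw [← C_mul, div_mul_cancel₀ _ hb]
        rw [ha, hc, this]
        simp only [C_0]
        ring
    · refine smul_left _ _ _ (c / a) ?_ hp hq
      have e1 : C c = C (c / a) * C a := by rw [← C_mul, div_mul_cancel₀ _ ha]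
      have e2 : C d = C (c / a) * C b := by
        rw [← C_mul]; congr 1; field_simp; linarith
      rw [e1, e2]
      ring
  -- the independent case
  obtain ⟨e, f, rfl⟩ := exists_eq_X_add_C_of_natDegree_le_one hl
  set x : ℝ[X] := C a * X + C b with hxd
  set y : ℝ[X] := C c * X + C d with hyd
  have h1 : γ.natDegree ≠ 0 := by
    intro h
    have hx0 : x.natDegree = 0 := by
      by_cases hx0 : x = 0
      · simp [hx0]
      rw [natDegree_mul hl0 hx0] at hd1; omega
    have hy0 : y.natDegree = 0 := by
      by_cases hy0 : y = 0
      · simp [hy0]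
      rw [natDegree_mul hl0 hy0] at hd2; omega
    have ha : a = 0 := by
      have : x.coeff 1 = a := by simp [hxd]
      rw [← this]; exact coeff_eq_zero_of_natDegree_lt (by omega)
    have hc : c = 0 := by
      have : y.coeff 1 = c := by simp [hyd]
      rw [← this]; exact coeff_eq_zero_of_natDegree_lt (by omega)
    apply hdet
    rw [ha, hc]; ring
  have h2 : γ.natDegree ≠ 1 := by
    intro h
    obtain ⟨t, ht⟩ := Polynomial.exists_root_of_degree_eq_one (p := γ)
      (by rw [degree_eq_natDegree hγ0, h]; rfl)
    exact hγ t ht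
  have hNe : ∀ t : ℝ, (x ^ 2 + y ^ 2).eval t ≠ 0 := by
    intro t ht
    simp only [hxd, hyd, eval_add, eval_mul, eval_C, eval_pow, eval_X] at ht
    have e1 : a * t + b = 0 := by nlinarith [sq_nonneg (a * t + b), sq_nonneg (c * t + d)]
    have e2 : c * t + d = 0 := by nlinarith [sq_nonneg (a * t + b), sq_nonneg (c * t + d)]
    apply hdet
    linear_combination a * e2 - c * e1
  have hN0 : x ^ 2 + y ^ 2 ≠ 0 := by
    intro h; exact hNe 0 (by rw [h]; simp)
  have hx1 : (x ^ 2).natDegree ≤ 2 := by rw [natDegree_pow]; omega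
  have hy1 : (y ^ 2).natDegree ≤ 2 := by rw [natDegree_pow]; omega
  have hxy1 : (x * y).natDegree ≤ 2 := natDegree_mul_le.trans (by omega)
  have hN1 : (x ^ 2 + y ^ 2).natDegree ≤ 2 :=
    (natDegree_add_le _ _).trans (max_le hx1 hy1)
  have hN2 : 2 ≤ (x ^ 2 + y ^ 2).natDegree := by
    apply le_natDegree_of_ne_zero
    have : x ^ 2 + y ^ 2 = C (a ^ 2 + c ^ 2) * X ^ 2 + C (2 * a * b + 2 * c * d) * X
        + C (b ^ 2 + d ^ 2) := by
      have : (C 2 : ℝ[X]) = 2 := rfl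
      simp only [hxd, hyd, C_add, C_mul, C_pow, this]
      ring
    have : (x ^ 2 + y ^ 2).coeff 2 = a ^ 2 + c ^ 2 := by
      rw [this]
      simp only [coeff_add, coeff_C_mul, coeff_X_pow, coeff_X, coeff_C]
      norm_num
    rw [this]
    intro h
    have ha : a = 0 := by nlinarith [sq_nonneg a, sq_nonneg c]
    have hc : c = 0 := by nlinarith [sq_nonneg a, sq_nonneg c]
    apply hdet
    rw [ha, hc]; ring
  have mk := frac_mem _ γ rfl hγ (x ^ 2 + y ^ 2) (by omega)
  have mA := frac_mem _ _ rfl hNe (x ^ 2) (by omega)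
  have mB := frac_mem _ _ rfl hNe (x * y) (by omega)
  have mC := frac_mem _ _ rfl hNe (y ^ 2) (by omega)
  have n1 := phi_ne hN0
  have n2 := phi_ne hγ0
  -- coefficients
  have hle : C e * X + C f = C ((e * d - f * c) / (a * d - b * c)) * x +
      C ((a * f - b * e) / (a * d - b * c)) * y := by
    have e1 : C e = C ((e * d - f * c) / (a * d - b * c)) * C a +
        C ((a * f - b * e) / (a * d - b * c)) * C c := by
      rw [← C_mul, ← C_mul, ← C_add, div_mul_eq_mul_div, div_mul_eq_mul_div, ← add_div]
      congr 1
      rw [eq_div_iff hdet]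
      ring
    have e2 : C f = C ((e * d - f * c) / (a * d - b * c)) * C b +
        C ((a * f - b * e) / (a * d - b * c)) * C d := by
      rw [← C_mul, ← C_mul, ← C_add, div_mul_eq_mul_div, div_mul_eq_mul_div, ← add_div]
      congr 1
      rw [eq_div_iff hdet]
      ring
    rw [hxd, hyd, e1, e2]
    ring
  set v := (e * d - f * c) / (a * d - b * c)
  set w := (a * f - b * e) / (a * d - b * c)
  have key := row_main ⟨_, mk⟩ _ _ ⟨_, mA⟩ ⟨_, mB⟩ ⟨_, mC⟩ (const_row v w)
    (by
      apply Subtype.ext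
      simp only [Subring.coe_add, Subring.coe_one]
      rw [← add_div, ← map_add, div_self n1])
    (by
      apply Subtype.ext
      simp only [Subring.coe_mul, map_mul, map_pow]
      ring)
  convert key using 3
  · congr 1
    · apply Subtype.ext
      simp only [Subring.coe_mul, Subring.coe_add]
      rw [hle, ← hxd]
      simp only [map_add, map_mul, map_pow] at n1 ⊢
      field_simp
    · congr 1
      apply Subtype.ext
      simp only [Subring.coe_mul, Subring.coe_add]
      rw [hle, ← hyd]
      simp only [map_add, map_mul, map_pow] at n1 ⊢
      field_simp

end DressAux

/-- Let `D` be the minimal Dress ring of `ℝ(X)`, `γ` a real polynomial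
without real roots, and `p = x/γ, q = y/γ ∈ D`.  If `deg x, deg y ≤ 1`, or if
`deg x = deg y = 2` and `gcd(x, y)` has degree at least `1`, then the matrix
`!![p, q; 0, 0]` over `D` is a product of idempotent `2×2` matrices over `D`. -/
theorem minimalDressRing_matrix_prod_idempotents_small_degree :
    (∀ (x y γ : Polynomial ℝ), (∀ t : ℝ, γ.eval t ≠ 0) →
      x.degree ≤ 1 → y.degree ≤ 1 →
      ∀ (hp : algebraMap (Polynomial ℝ) (RatFunc ℝ) x /
            algebraMap (Polynomial ℝ) (RatFunc ℝ) γ ∈ minimalDressRing)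
        (hq : algebraMap (Polynomial ℝ) (RatFunc ℝ) y /
            algebraMap (Polynomial ℝ) (RatFunc ℝ) γ ∈ minimalDressRing),
        !![(⟨_, hp⟩ : ↥minimalDressRing), ⟨_, hq⟩; 0, 0] ∈
          Submonoid.closure
            {E : Matrix (Fin 2) (Fin 2) ↥minimalDressRing | E * E = E}) ∧
    (∀ (x y γ : Polynomial ℝ), (∀ t : ℝ, γ.eval t ≠ 0) →
      x.natDegree = 2 → y.natDegree = 2 → 1 ≤ (EuclideanDomain.gcd x y).natDegree →
      ∀ (hp : algebraMap (Polynomial ℝ) (RatFunc ℝ) x /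
            algebraMap (Polynomial ℝ) (RatFunc ℝ) γ ∈ minimalDressRing)
        (hq : algebraMap (Polynomial ℝ) (RatFunc ℝ) y /
            algebraMap (Polynomial ℝ) (RatFunc ℝ) γ ∈ minimalDressRing),
        !![(⟨_, hp⟩ : ↥minimalDressRing), ⟨_, hq⟩; 0, 0] ∈
          Submonoid.closure
            {E : Matrix (Fin 2) (Fin 2) ↥minimalDressRing | E * E = E}) := by
  constructor
  · intro x y γ hγ hx hy hp hq
    have key := DressAux.main 1 x y γ hγ (by simp) (natDegree_le_iff_degree_le.2 hx)
      (natDegree_le_iff_degree_le.2 hy) (by rwa [one_mul]) (by rwa [one_mul])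
    simp only [one_mul] at key
    exact key
  · intro x y γ hγ hx hy hg hp hq
    have hx0 : x ≠ 0 := by rintro rfl; simp at hx
    have hy0 : y ≠ 0 := by rintro rfl; simp at hy
    obtain ⟨x', hx'⟩ := EuclideanDomain.gcd_dvd_left x y
    obtain ⟨y', hy'⟩ := EuclideanDomain.gcd_dvd_right x y
    generalize EuclideanDomain.gcd x y = g at *
    subst hx' hy'
    have dx := natDegree_mul (left_ne_zero_of_mul hx0) (right_ne_zero_of_mul hx0)
    have dy := natDegree_mul (left_ne_zero_of_mul hy0) (right_ne_zero_of_mul hy0)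
    by_cases h2 : g.natDegree ≤ 1
    · exact DressAux.main g x' y' γ hγ h2 (by omega) (by omega) hp hq
    · have ex := eq_C_of_natDegree_eq_zero (p := x') (by omega)
      have ey := eq_C_of_natDegree_eq_zero (p := y') (by omega)
      have hc : x'.coeff 0 ≠ 0 := by
        intro h
        rw [h] at ex
        exact right_ne_zero_of_mul hx0 (by rw [ex]; simp)
      refine DressAux.smul_left _ _ _ (y'.coeff 0 / x'.coeff 0) ?_ hp hq
      have : C (y'.coeff 0) = C (y'.coeff 0 / x'.coeff 0) * C (x'.coeff 0) := by
        rw [← C_mul, div_mul_cancel₀ _ hc]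
      conv_lhs => rw [ey, this]
      conv_rhs => rw [ex]
      simp only [coeff_C_zero]
      ring
end
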